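/- arXiv:2306.07253 — 2 statements merged into one kernel-verified Lean document; each statement's English description precedes it below -/
import Mathlib

section
/- Let n, k, t be integers with t = α(n) − O(1) and n/k = t − Θ(1). Then ln(E_{n,k,t}) = L_0(n,k,t) + O(ln^{3/2} n). -/
open Filter
open scoped BigOperators Classical

noncomputable section

/-- The number of edges of a simple graph on `Fin n`. -/
def edgeCount {n : ℕ} (G : SimpleGraph (Fin n)) : ℕ := Nat.card G.edgeSet

/-- Probability of a graph property under the uniform random graph `G(n,m)`. -/
def Pm (n m : ℕ) (E : SimpleGraph (Fin n) → Prop) : ℝ :=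
  (Nat.card {G : SimpleGraph (Fin n) // edgeCount G = m ∧ E G} : ℝ) /
    (Nat.card {G : SimpleGraph (Fin n) // edgeCount G = m} : ℝ)

/-- Expectation of a real functional under the uniform random graph `G(n,m)`. -/
def Em (n m : ℕ) (X : SimpleGraph (Fin n) → ℝ) : ℝ :=
  (∑ᶠ G : {G : SimpleGraph (Fin n) // edgeCount G = m}, X G.1) /
    (Nat.card {G : SimpleGraph (Fin n) // edgeCount G = m} : ℝ)

/-- Probability of a graph property under the binomial random graph `G(n,p)`. -/
def Pp (n : ℕ) (p : ℝ) (E : SimpleGraph (Fin n) → Prop) : ℝ :=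
  ∑ᶠ G : SimpleGraph (Fin n),
    (if E G then (1 : ℝ) else 0) * p ^ edgeCount G * (1 - p) ^ (n.choose 2 - edgeCount G)

/-- Expectation of a real functional under the binomial random graph `G(n,p)`. -/
def Ep (n : ℕ) (p : ℝ) (X : SimpleGraph (Fin n) → ℝ) : ℝ :=
  ∑ᶠ G : SimpleGraph (Fin n),
    X G * p ^ edgeCount G * (1 - p) ^ (n.choose 2 - edgeCount G)

/-- `α₀(n) = 2 log_b n − 2 log_b log_b n + 2 log_b (e/2) + 1`. -/
def alpha0 (b : ℝ) (n : ℕ) : ℝ :=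
  2 * Real.logb b n - 2 * Real.logb b (Real.logb b n) + 2 * Real.logb b (Real.exp 1 / 2) + 1

/-- `α(n) = ⌊α₀(n)⌋`. -/
def alphaNat (b : ℝ) (n : ℕ) : ℕ := ⌊alpha0 b n⌋₊

/-- `μ_t = C(n,t) q^{C(t,2)}`, the expected number of independent `t`-sets. -/
def muExp (q : ℝ) (n t : ℕ) : ℝ := (n.choose t : ℝ) * q ^ t.choose 2

/-- A finset of vertices is independent in `G`. -/
def IndepFinset {n : ℕ} (G : SimpleGraph (Fin n)) (s : Finset (Fin n)) : Prop :=
  ∀ v ∈ s, ∀ w ∈ s, ¬ G.Adj v w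

/-- `G` has a proper colouring with `k` colours, all colour classes of size at most `t`. -/
def HasBoundedColouring {n : ℕ} (G : SimpleGraph (Fin n)) (t k : ℕ) : Prop :=
  ∃ C : Fin n → Fin k, (∀ v w, G.Adj v w → C v ≠ C w) ∧
    ∀ c : Fin k, (Finset.univ.filter fun v => C v = c).card ≤ t

/-- The `t`-bounded chromatic number `χ_t(G)`. -/
def chiBounded {n : ℕ} (G : SimpleGraph (Fin n)) (t : ℕ) : ℕ :=
  sInf {k | HasBoundedColouring G t k}

/-- `G` has an equitable proper colouring with `k` colours. -/
def HasEquitableColouring {n : ℕ} (G : SimpleGraph (Fin n)) (k : ℕ) : Prop :=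
  ∃ C : Fin n → Fin k, (∀ v w, G.Adj v w → C v ≠ C w) ∧
    ∀ c c' : Fin k,
      (Finset.univ.filter fun v => C v = c).card ≤
        (Finset.univ.filter fun v => C v = c').card + 1

/-- The equitable chromatic number `χ₌(G)`. -/
def chiEquitable {n : ℕ} (G : SimpleGraph (Fin n)) : ℕ :=
  sInf {k | HasEquitableColouring G k}

/-- The number of unordered `t`-bounded proper `k`-colourings of `G`, i.e. partitions of the
vertex set into exactly `k` nonempty independent sets, each of size at most `t`. -/
def numUnorderedColourings (n t k : ℕ) (G : SimpleGraph (Fin n)) : ℕ :=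
  Set.ncard {Q : Finset (Finset (Fin n)) | Q.card = k ∧
    (∀ s ∈ Q, s.Nonempty ∧ s.card ≤ t ∧ IndepFinset G s) ∧
    (∀ v : Fin n, ∃ s ∈ Q, v ∈ s) ∧
    ∀ s ∈ Q, ∀ s' ∈ Q, s ≠ s' → Disjoint s s'}

/-- `E_{n,k,t}`: the expected number of unordered `t`-bounded `k`-colourings of `G_{n,1/2}`. -/
def Enkt (n k t : ℕ) : ℝ := Ep n (1/2) fun G => (numUnorderedColourings n t k G : ℝ)

/-- The `t`-bounded first moment threshold `k_t(n)`. -/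
def fmThreshold (n t : ℕ) : ℕ := sInf {k | 1 ≤ Enkt n k t}

/-- `P` is a (possibly partial) `k`-colouring profile on `n` vertices. -/
def IsProfile (n k : ℕ) (P : ℕ → ℕ) : Prop :=
  (∀ u, u ∉ Finset.Icc 1 n → P u = 0) ∧
    (∑ u ∈ Finset.Icc 1 n, P u = k) ∧ (∑ u ∈ Finset.Icc 1 n, u * P u ≤ n)

/-- A colouring profile is complete if its classes use all `n` vertices. -/
def IsCompleteProfile (n : ℕ) (P : ℕ → ℕ) : Prop :=
  ∑ u ∈ Finset.Icc 1 n, u * P u = n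

/-- A colouring profile is `t`-bounded if it has no classes of size larger than `t`. -/
def IsBoundedProfile (t : ℕ) (P : ℕ → ℕ) : Prop := ∀ u, t < u → P u = 0

/-- The number of parts of a profile on `n` vertices. -/
def profileParts (n : ℕ) (P : ℕ → ℕ) : ℕ := ∑ u ∈ Finset.Icc 1 n, P u

/-- `X_k`: the number of ordered (partial) proper colourings of `G` with profile `P`:
ordered tuples of pairwise disjoint independent sets, decreasing in size, with exactly
`P u` parts of size `u` for every `u`. -/
def Xprofile {n : ℕ} (G : SimpleGraph (Fin n)) (P : ℕ → ℕ) : ℕ :=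
  Set.ncard {V : Fin (profileParts n P) → Finset (Fin n) |
    (∀ i j, i ≠ j → Disjoint (V i) (V j)) ∧
    (∀ i j, i ≤ j → (V j).card ≤ (V i).card) ∧
    (∀ u : ℕ, (Finset.univ.filter fun i => (V i).card = u).card = P u) ∧
    ∀ i, IndepFinset G (V i)}

/-- `X̄_k = X_k / ∏_u k_u!`: the number of unordered colourings with profile `P`. -/
def Xbar {n : ℕ} (G : SimpleGraph (Fin n)) (P : ℕ → ℕ) : ℝ :=
  (Xprofile G P : ℝ) / ∏ u ∈ Finset.Icc 1 n, ((P u).factorial : ℝ)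

/-- `κ = Σ_u κ_u` where `κ_u = u k_u / n`. -/
def kappaTot (n : ℕ) (P : ℕ → ℕ) : ℝ := ∑ u ∈ Finset.Icc 1 n, (u : ℝ) * P u / n

/-- `m = ⌊p N⌋` with `N = C(n,2)`. -/
def mFloor (p : ℝ) (n : ℕ) : ℕ := ⌊p * (n.choose 2 : ℝ)⌋₊

/-- Definition 2.2: a sequence `P` of complete `a`-bounded colouring profiles is tame. -/
def IsTame (p : ℝ) (a : ℕ → ℕ) (P : ℕ → ℕ → ℕ) : Prop :=
  (∃ C : ℝ, ∀ᶠ n in atTop, alpha0 (1/(1-p)) n - C ≤ (a n : ℝ)) ∧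
  (∀ᶠ n in atTop, a n ≤ alphaNat (1/(1-p)) n) ∧
  (∀ n, IsProfile n (profileParts n (P n)) (P n) ∧ IsCompleteProfile n (P n) ∧
      IsBoundedProfile (a n) (P n)) ∧
  ∃ c : ℝ, c ∈ Set.Ioo (0:ℝ) 1 ∧ ∃ γ : ℕ → ℝ, Monotone γ ∧ Tendsto γ atTop atTop ∧
    (∀ᶠ n in atTop, ∀ u, 1 ≤ u → u ≤ a n →
      (u : ℝ) * P n u / n <
        (1/(1-p)) ^ (-(((alphaNat (1/(1-p)) n - u : ℕ) : ℝ) *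
          γ (alphaNat (1/(1-p)) n - u)))) ∧
    ∀ ε : ℝ, 0 < ε → ∀ᶠ n : ℕ in atTop,
      Real.exp (-ε * (n : ℝ) ^ ((1:ℝ) - c)) ≤ Em n (mFloor p n) fun G => Xbar G (P n)

/-- The function `φ(κ)` from Lemma 3.3. -/
def phiProfile (p : ℝ) (n : ℕ) (P : ℕ → ℕ) : ℝ :=
  -(1 - kappaTot n P) * Real.log (1 - kappaTot n P) +
    Real.log (1/(1-p)) / 2 * ∑ u ∈ Finset.Icc 1 n,
      ((u : ℝ) * P u / n) * (alpha0 (1/(1-p)) n - 1 - 2 / Real.log (1/(1-p)) - (u : ℝ))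

/-- The function `φ̃_δ(x)` from Lemma 3.5. -/
def phiTilde (p δ x : ℝ) : ℝ :=
  -(1 - x) * Real.log (1 - x) - (1 - Real.log (1/(1-p)) / 2 * δ) * x

/-- `d_u = 2^{C(u,2)} u!`. -/
def dcoef (u : ℕ) : ℝ := 2 ^ u.choose 2 * (u.factorial : ℝ)

/-- `L_0(n,k,t)`: the supremum of `L_k` over real-valued `t`-bounded complete profiles. -/
def L0 (n k t : ℕ) : ℝ :=
  sSup {y : ℝ | ∃ f : ℕ → ℝ, (∀ u ∈ Finset.Icc 1 t, 0 ≤ f u) ∧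
    (∑ u ∈ Finset.Icc 1 t, f u = (k : ℝ)) ∧ (∑ u ∈ Finset.Icc 1 t, (u : ℝ) * f u = (n : ℝ)) ∧
    y = (n : ℝ) * Real.log n - (n : ℝ) + (k : ℝ) -
      ∑ u ∈ Finset.Icc 1 t, f u * Real.log (f u * dcoef u)}

/-- Membership in `P_{n,k,t}`: a `t`-bounded complete `k`-colouring profile on `n` vertices. -/
def IsKTProfile (n k t : ℕ) (P : ℕ → ℕ) : Prop :=
  (∀ u, u ∉ Finset.Icc 1 t → P u = 0) ∧
    (∑ u ∈ Finset.Icc 1 t, P u = k) ∧ (∑ u ∈ Finset.Icc 1 t, u * P u = n)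

/-- `E_{n,k,t}` written as the sum over profiles of `E_{1/2}[X̄_k]`. -/
def EnktSum (n k t : ℕ) : ℝ :=
  ∑ᶠ P : ℕ → ℕ, if IsKTProfile n k t P then Ep n (1/2) fun G => Xbar G P else 0



lemma card_fib_eq {n : ℕ} {ι : Type*} [Fintype ι] (m : ι → ℕ) (hm : ∑ i, m i = n) :
    (Finset.univ.filter fun c : Fin n → ι =>
      ∀ i, (Finset.univ.filter fun j => c j = i).card = m i).card = Nat.multinomial Finset.univ m := by
  have h1 := Fintype.sum_pow (fun i : ι => (MvPolynomial.X i : MvPolynomial ι ℕ)) n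
  have h2 := Finset.sum_pow_eq_sum_piAntidiag (Finset.univ : Finset ι)
    (fun i : ι => (MvPolynomial.X i : MvPolynomial ι ℕ)) n
  rw [h1] at h2
  have key : ∀ m' : ι → ℕ, (∏ i, (MvPolynomial.X i : MvPolynomial ι ℕ) ^ m' i)
      = MvPolynomial.monomial (Finsupp.equivFunOnFinite.symm m') 1 := by
    intro m'
    rw [MvPolynomial.monomial_eq]
    simp [Finsupp.prod_fintype]
  have key2 : ∀ c : Fin n → ι, (∏ j, (MvPolynomial.X (c j) : MvPolynomial ι ℕ))
      = MvPolynomial.monomial (Finsupp.equivFunOnFinite.symm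
          (fun i => (Finset.univ.filter fun j => c j = i).card)) 1 := by
    intro c
    rw [← key]
    rw [← Finset.prod_fiberwise Finset.univ c]
    apply Finset.prod_congr rfl
    intro i _
    rw [Finset.prod_congr rfl (g := fun _ => MvPolynomial.X i)]
    · simp
    · intro j hj
      simp at hj
      rw [hj]
  have h3 := congrArg (MvPolynomial.coeff (Finsupp.equivFunOnFinite.symm m)) h2
  simp only [key, key2, MvPolynomial.coeff_sum, MvPolynomial.coeff_monomial,
    EmbeddingLike.apply_eq_iff_eq] at h3
  rw [Finset.card_filter]
  simp only [funext_iff] at h3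
  rw [h3]
  rw [Finset.sum_eq_single m]
  · rw [← map_natCast (MvPolynomial.C : ℕ →+* MvPolynomial ι ℕ), MvPolynomial.coeff_C_mul,
      MvPolynomial.coeff_monomial]
    simp
  · intro b hb hbm
    rw [← map_natCast (MvPolynomial.C : ℕ →+* MvPolynomial ι ℕ), MvPolynomial.coeff_C_mul,
      MvPolynomial.coeff_monomial]
    simp [hbm]
  · intro h
    exact absurd (by simp [hm]) h

lemma card_proper {n : ℕ} {ι : Type*} [Fintype ι] (c : Fin n → ι) :
    (Finset.univ.filter fun G : SimpleGraph (Fin n) => ∀ v w, G.Adj v w → c v ≠ c w).card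
      * 2 ^ (∑ i, ((Finset.univ.filter fun j => c j = i).card).choose 2) = 2 ^ (n.choose 2) := by
  set T : Finset (Sym2 (Fin n)) := (⊤ : SimpleGraph (Fin n)).edgeFinset with hT
  set M : Finset (Sym2 (Fin n)) := Finset.univ.biUnion fun i : ι =>
    ((Finset.univ.filter fun j => c j = i).offDiag.image Sym2.mk.uncurry) with hM
  have hMT : M ⊆ T := by
    intro e
    induction e using Sym2.ind with
    | _ a b =>
      simp only [hM, hT, Finset.mem_biUnion, Finset.mem_image, Finset.mem_offDiag]
      rintro ⟨i, -, ⟨p, q⟩, ⟨hp, hq, hpq⟩, he⟩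
      simp at he hpq ⊢
      rintro rfl
      rcases he with ⟨rfl, rfl⟩ | ⟨rfl, rfl⟩ <;> exact hpq rfl
  have hMmem : ∀ a b, s(a,b) ∈ M ↔ a ≠ b ∧ c a = c b := by
    intro a b
    simp only [hM, Finset.mem_biUnion, Finset.mem_image, Finset.mem_offDiag]
    constructor
    · rintro ⟨i, -, ⟨p, q⟩, ⟨hp, hq, hpq⟩, he⟩
      simp at he hpq hp hq ⊢
      rcases he with ⟨rfl, rfl⟩ | ⟨rfl, rfl⟩
      · exact ⟨hpq, by rw [hp, hq]⟩
      · exact ⟨fun h => hpq h.symm, by rw [hp, hq]⟩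
    · rintro ⟨h1, h2⟩
      exact ⟨c b, by simp, (a, b), by simp [h1, h2], by simp⟩
  have hMcard : M.card = ∑ i, ((Finset.univ.filter fun j => c j = i).card).choose 2 := by
    rw [hM, Finset.card_biUnion]
    · exact Finset.sum_congr rfl fun i _ => Sym2.card_image_offDiag _
    · intro i _ i' _ hii
      rw [Function.onFun, Finset.disjoint_left]
      intro e
      induction e using Sym2.ind with
      | _ a b =>
        simp only [Finset.mem_image, Finset.mem_offDiag]
        rintro ⟨⟨p, q⟩, ⟨hp, hq, hpq⟩, he⟩ ⟨⟨p', q'⟩, ⟨hp', hq', hpq'⟩, he'⟩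
        simp at he hp hq he' hp' hq'
        apply hii
        rcases he with ⟨rfl, rfl⟩ | ⟨rfl, rfl⟩ <;> rcases he' with ⟨rfl, rfl⟩ | ⟨rfl, rfl⟩ <;>
          simp_all
  have hTcard : T.card = n.choose 2 := by
    have := SimpleGraph.card_edgeFinset_top_eq_card_choose_two (V := Fin n)
    simp only [Fintype.card_fin] at this
    rw [← this, hT]
  have hG : (Finset.univ.filter fun G : SimpleGraph (Fin n) => ∀ v w, G.Adj v w → c v ≠ c w).card
      = (T \ M).powerset.card := by
    apply Finset.card_nbij (fun G => G.edgeFinset)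
    · intro G hG
      simp only [Finset.coe_filter, Finset.mem_univ, true_and, Set.mem_ofPred_eq] at hG
      simp only [Finset.coe_powerset, Set.mem_preimage, Set.mem_powerset_iff, Finset.coe_subset]
      intro e
      induction e using Sym2.ind with
      | _ a b =>
        intro he
        simp only [SimpleGraph.mem_edgeFinset, SimpleGraph.mem_edgeSet] at he
        rw [Finset.mem_sdiff, hMmem]
        refine ⟨by simp [hT, he.ne], fun h => hG a b he h.2⟩
    · intro G _ G' _ h
      simpa using h
    · intro S hS
      simp only [Finset.coe_powerset, Set.mem_preimage, Set.mem_powerset_iff, Finset.coe_subset] at hS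
      have hmem : ∀ a b, s(a,b) ∈ S → a ≠ b ∧ c a ≠ c b := by
        intro a b h
        have h' := hS h
        rw [Finset.mem_sdiff, hMmem] at h'
        have hab : a ≠ b := by simpa [hT] using h'.1
        exact ⟨hab, fun h => h'.2 ⟨hab, h⟩⟩
      refine ⟨SimpleGraph.fromEdgeSet (S : Set _), ?_, ?_⟩
      · simp only [Finset.coe_filter, Finset.mem_univ, true_and, Set.mem_ofPred_eq]
        intro v w h
        rw [SimpleGraph.fromEdgeSet_adj] at h
        exact (hmem v w (by simpa using h.1)).2
      · ext e
        induction e using Sym2.ind with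
        | _ a b =>
          simp only [SimpleGraph.mem_edgeFinset, SimpleGraph.mem_edgeSet,
            SimpleGraph.fromEdgeSet_adj, Finset.mem_coe]
          exact ⟨fun h => h.1, fun h => ⟨h, (hmem a b h).1⟩⟩
  rw [hG, Finset.card_powerset, ← hMcard, ← pow_add, Finset.card_sdiff_of_subset hMT, hTcard]
  congr 1
  have := Finset.card_le_card hMT
  omega


/-- The fibre of a colouring. -/
def fib {n : ℕ} {ι : Type*} (c : Fin n → ι) (i : ι) : Finset (Fin n) :=
  Finset.univ.filter fun j => c j = i

lemma mem_fib {n : ℕ} {ι : Type*} (c : Fin n → ι) (i : ι) (j : Fin n) :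
    j ∈ fib c i ↔ c j = i := by simp [fib]

/-- Properness of a colouring. -/
def ProperCol {n : ℕ} {ι : Type*} (G : SimpleGraph (Fin n)) (c : Fin n → ι) : Prop :=
  ∀ v w, G.Adj v w → c v ≠ c w

lemma card_fib_eq' {n : ℕ} {ι : Type*} [Fintype ι] (m : ι → ℕ) (hm : ∑ i, m i = n) :
    (Finset.univ.filter fun c : Fin n → ι => ∀ i, (fib c i).card = m i).card
      = Nat.multinomial Finset.univ m := by
  rw [← card_fib_eq m hm]
  rfl

lemma card_proper' {n : ℕ} {ι : Type*} [Fintype ι] (c : Fin n → ι) :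
    (Finset.univ.filter fun G : SimpleGraph (Fin n) => ProperCol G c).card
      * 2 ^ (∑ i, ((fib c i).card).choose 2) = 2 ^ (n.choose 2) := by
  rw [← card_proper c]
  unfold fib ProperCol
  congr!

/-- Ordered bounded proper colourings with nonempty classes. -/
def ordCol (n t k : ℕ) (G : SimpleGraph (Fin n)) : Finset (Fin n → Fin k) :=
  Finset.univ.filter fun c => (∀ i, 1 ≤ (fib c i).card ∧ (fib c i).card ≤ t) ∧
    ProperCol G c

lemma card_ordCol (n t k : ℕ) (G : SimpleGraph (Fin n)) :
    (ordCol n t k G).card = numUnorderedColourings n t k G * k.factorial := by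
  set S : Finset (Finset (Finset (Fin n))) := Finset.univ.filter fun Q => Q.card = k ∧
    (∀ s ∈ Q, s.Nonempty ∧ s.card ≤ t ∧ IndepFinset G s) ∧
    (∀ v : Fin n, ∃ s ∈ Q, v ∈ s) ∧
    ∀ s ∈ Q, ∀ s' ∈ Q, s ≠ s' → Disjoint s s' with hS
  have hnum : numUnorderedColourings n t k G = S.card := by
    rw [numUnorderedColourings, ← Set.ncard_coe_finset]
    congr 1
    ext Q
    simp [hS]
  have hsurj : ∀ c ∈ ordCol n t k G, Function.Surjective c := by
    intro c hc i
    simp only [ordCol, Finset.mem_filter] at hc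
    obtain ⟨j, hj⟩ := Finset.card_pos.1 (hc.2.1 i).1
    exact ⟨j, (mem_fib _ _ _).1 hj⟩
  have hfibinj : ∀ c ∈ ordCol n t k G, Function.Injective (fib c) := by
    intro c hc i i' h
    obtain ⟨j, hj⟩ := hsurj c hc i
    rw [← hj]
    rw [← mem_fib, ← h, mem_fib, hj]
  rw [hnum, Finset.card_eq_sum_card_fiberwise (f := fun c => Finset.univ.image (fib c)) (t := S)]
  · rw [Finset.sum_const_nat (m := k.factorial)]
    intro Q hQ
    simp only [hS, Finset.mem_filter, Finset.mem_univ, true_and] at hQ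
    obtain ⟨hQk, hQ1, hQ2, hQ3⟩ := hQ
    -- a base colouring
    have e : Q ≃ Fin k := Finset.equivFinOfCardEq hQk
    choose g hg1 hg2 using hQ2
    let c0 : Fin n → Fin k := fun v => e ⟨g v, hg1 v⟩
    have hfib0 : ∀ s : Q, fib c0 (e s) = s.1 := by
      intro s
      ext v
      rw [mem_fib]
      simp only [c0, EmbeddingLike.apply_eq_iff_eq]
      constructor
      · intro h; rw [← h]; exact hg2 v
      · intro h
        by_contra hne
        have := hQ3 (g v) (hg1 v) s.1 s.2 (fun h' => hne (Subtype.ext h'))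
        exact Finset.disjoint_left.1 this (hg2 v) h
    have hfib0' : ∀ i, fib c0 i = (e.symm i).1 := by
      intro i
      have := hfib0 (e.symm i)
      simpa using this
    have hsurj0 : Function.Surjective c0 := by
      intro i
      obtain ⟨v, hv⟩ := (hQ1 _ (e.symm i).2).1
      refine ⟨v, ?_⟩
      rw [← hfib0', mem_fib] at hv
      exact hv
    have hfibσ : ∀ (σ : Equiv.Perm (Fin k)) i, fib (fun v => σ (c0 v)) i = fib c0 (σ.symm i) := by
      intro σ i
      ext v
      simp only [mem_fib]
      exact (Equiv.eq_symm_apply σ).symm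
    have hcard : (Finset.univ : Finset (Equiv.Perm (Fin k))).card = k.factorial := by
      simp [Fintype.card_perm]
    rw [← hcard]
    symm
    apply Finset.card_nbij (fun σ v => σ (c0 v))
    · intro σ _
      simp only [Finset.coe_filter, Set.mem_ofPred_eq, ordCol, Finset.mem_filter, Finset.mem_univ,
        true_and]
      refine ⟨⟨fun i => ?_, fun v w h hvw => ?_⟩, ?_⟩
      · rw [hfibσ, hfib0']
        have := hQ1 _ (e.symm (σ.symm i)).2
        exact ⟨Finset.card_pos.2 this.1, this.2.1⟩
      · have hvw' := σ.injective hvw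
        have h1 := (mem_fib c0 _ v).2 rfl
        have h2 := (mem_fib c0 _ w).2 hvw'.symm
        rw [hfib0'] at h1 h2
        exact (hQ1 _ (e.symm (c0 v)).2).2.2 v h1 w h2 h
      · ext s
        simp only [Finset.mem_image, Finset.mem_univ, true_and]
        constructor
        · rintro ⟨i, rfl⟩
          rw [hfibσ, hfib0']
          exact (e.symm (σ.symm i)).2
        · intro hs
          refine ⟨σ (e ⟨s, hs⟩), ?_⟩
          rw [hfibσ, hfib0']
          simp
    · intro σ _ σ' _ h
      ext i
      obtain ⟨v, rfl⟩ := hsurj0 i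
      exact congrArg Fin.val (congrFun h v)
    · intro c hc
      simp only [Finset.coe_filter, Set.mem_ofPred_eq] at hc
      obtain ⟨hc, hcQ⟩ := hc
      have hmemQ : ∀ i, fib c i ∈ Q := by
        intro i; rw [← hcQ]; exact Finset.mem_image_of_mem _ (Finset.mem_univ _)
      let τ : Fin k → Fin k := fun i => e ⟨fib c i, hmemQ i⟩
      have hτinj : Function.Injective τ := by
        intro i i' h
        have := e.injective h
        exact hfibinj c hc (congrArg Subtype.val this)
      have hτ : Function.Bijective τ := Finite.injective_iff_bijective.1 hτinj
      refine ⟨(Equiv.ofBijective τ hτ).symm, by simp, ?_⟩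
      funext v
      show (Equiv.ofBijective τ hτ).symm (c0 v) = c v
      rw [Equiv.symm_apply_eq]
      show c0 v = e ⟨fib c (c v), hmemQ _⟩
      simp only [c0, EmbeddingLike.apply_eq_iff_eq]
      apply Subtype.ext
      by_contra hne
      have := hQ3 (g v) (hg1 v) (fib c (c v)) (hmemQ _) hne
      exact Finset.disjoint_left.1 this (hg2 v) ((mem_fib _ _ _).2 rfl)
  · intro c hc
    have hc' := hc
    simp only [ordCol, Finset.coe_filter, Finset.mem_univ, true_and, Set.mem_ofPred_eq] at hc'
    simp only [hS, Finset.coe_filter, Finset.mem_univ, true_and, Set.mem_ofPred_eq]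
    refine ⟨?_, ?_, ?_, ?_⟩
    · rw [Finset.card_image_of_injective _ (hfibinj c hc)]
      simp
    · simp only [Finset.mem_image, Finset.mem_univ, true_and]
      rintro s ⟨i, rfl⟩
      refine ⟨Finset.card_pos.1 (hc'.1 i).1, (hc'.1 i).2, ?_⟩
      intro v hv w hw h
      rw [mem_fib] at hv hw
      exact hc'.2 v w h (by rw [hv, hw])
    · intro v
      exact ⟨fib c (c v), Finset.mem_image_of_mem _ (Finset.mem_univ _), (mem_fib _ _ _).2 rfl⟩
    · simp only [Finset.mem_image, Finset.mem_univ, true_and]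
      rintro s ⟨i, rfl⟩ s' ⟨i', rfl⟩ hne
      rw [Finset.disjoint_left]
      intro v hv hv'
      rw [mem_fib] at hv hv'
      exact hne (by rw [← hv, ← hv'])

lemma Enkt_eq (n k t : ℕ) :
    Enkt n k t * k.factorial = n.factorial *
      ∑ m ∈ (Fintype.piFinset fun _ : Fin k => Finset.Icc 1 t).filter (fun m => ∑ i, m i = n),
        ∏ i, (1 / dcoef (m i)) := by
  have hedge : ∀ G : SimpleGraph (Fin n), edgeCount G ≤ n.choose 2 := by
    intro G
    have := SimpleGraph.card_edgeFinset_le_card_choose_two (G := G)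
    rw [edgeCount, Nat.card_eq_fintype_card, ← SimpleGraph.edgeFinset_card]
    simpa using this
  have h1 : Enkt n k t * k.factorial = ∑ G : SimpleGraph (Fin n),
      ((ordCol n t k G).card : ℝ) * (1/2) ^ (n.choose 2) := by
    rw [Enkt, Ep, finsum_eq_sum_of_fintype, Finset.sum_mul]
    apply Finset.sum_congr rfl
    intro G _
    rw [card_ordCol, mul_assoc (numUnorderedColourings n t k G : ℝ)]
    have : (1 - 1/2 : ℝ) = 1/2 := by norm_num
    rw [this, ← pow_add, Nat.add_sub_cancel' (hedge G)]
    push_cast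
    ring
  have h2 : ∑ G : SimpleGraph (Fin n), ((ordCol n t k G).card : ℝ) * (1/2) ^ (n.choose 2)
      = ∑ c ∈ (Finset.univ.filter fun c : Fin n → Fin k =>
          ∀ i, 1 ≤ (fib c i).card ∧ (fib c i).card ≤ t),
          ∏ i, (1/2 : ℝ) ^ ((fib c i).card.choose 2) := by
    rw [← Finset.sum_mul]
    have : ∀ G : SimpleGraph (Fin n), ((ordCol n t k G).card : ℝ) =
        ∑ c ∈ (Finset.univ.filter fun c : Fin n → Fin k =>
          ∀ i, 1 ≤ (fib c i).card ∧ (fib c i).card ≤ t),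
          if ProperCol G c then (1:ℝ) else 0 := by
      intro G
      rw [← Finset.sum_filter, Finset.filter_filter, Finset.sum_const]
      simp [ordCol]
    simp only [this]
    rw [Finset.sum_comm, Finset.sum_mul]
    apply Finset.sum_congr rfl
    intro c _
    rw [← Finset.sum_filter, Finset.sum_const, Finset.prod_pow_eq_pow_sum]
    have h3 := card_proper' c
    have h4 := congrArg (Nat.cast (R := ℝ)) h3
    push_cast at h4
    rw [nsmul_eq_mul, mul_one]
    have e1 : (1/2:ℝ)^(n.choose 2) = 1 / 2^(n.choose 2) := by simp
    have e2 : ∀ a : ℕ, (1/2:ℝ)^a = 1 / 2^a := by simp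
    rw [e1, e2, ← h4]
    have hne : ((Finset.univ.filter fun G : SimpleGraph (Fin n) =>
        ProperCol G c).card : ℝ) ≠ 0 := by
      intro h0
      rw [h0, zero_mul] at h4
      exact absurd h4.symm (by positivity)
    field_simp
  rw [h1, h2]
  rw [← Finset.sum_fiberwise_of_maps_to
    (t := (Fintype.piFinset fun _ : Fin k => Finset.Icc 1 t).filter (fun m => ∑ i, m i = n))
    (g := fun c i => (fib c i).card)]
  · rw [Finset.mul_sum]
    apply Finset.sum_congr rfl
    intro m hm
    simp only [Finset.mem_filter, Fintype.mem_piFinset, Finset.mem_Icc] at hm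
    rw [Finset.filter_filter]
    have : (Finset.univ.filter fun c : Fin n → Fin k =>
        (∀ i, 1 ≤ (fib c i).card ∧ (fib c i).card ≤ t) ∧ (fun i => (fib c i).card) = m)
        = Finset.univ.filter fun c : Fin n → Fin k =>
      ∀ i, (fib c i).card = m i := by
      ext c
      simp only [Finset.mem_filter, Finset.mem_univ, true_and, funext_iff]
      constructor
      · rintro ⟨_, h⟩; exact h
      · intro h
        refine ⟨fun i => ?_, h⟩
        have : (fib c i).card = m i := h i
        rw [this]; exact hm.1 i
    rw [this]
    rw [Finset.sum_congr rfl (g := fun _ => ∏ i, (1/2 : ℝ) ^ ((m i).choose 2))]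
    · have hcard : (Finset.univ.filter fun c : Fin n → Fin k => ∀ i, (fib c i).card = m i).card
          = Nat.multinomial Finset.univ m := by
        rw [← card_fib_eq' m hm.2]
        congr!
      rw [Finset.sum_const, hcard, nsmul_eq_mul]
      have hs := Nat.multinomial_spec Finset.univ m
      rw [hm.2] at hs
      have hs' := congrArg (Nat.cast (R := ℝ)) hs
      push_cast at hs'
      rw [← hs', mul_comm (∏ i, ((m i).factorial : ℝ)), mul_assoc, ← Finset.prod_mul_distrib]
      congr 1
      apply Finset.prod_congr rfl
      intro i _
      rw [dcoef]
      have : ((m i).factorial : ℝ) ≠ 0 := by positivity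
      field_simp
      rw [← mul_pow]; norm_num
    · intro c hc
      simp only [Finset.mem_filter, Finset.mem_univ, true_and] at hc
      apply Finset.prod_congr rfl
      intro i _
      rw [hc i]
  · intro c hc
    simp only [Finset.mem_filter, Finset.mem_univ, true_and] at hc
    simp only [Finset.mem_filter, Fintype.mem_piFinset, Finset.mem_Icc]
    refine ⟨hc, ?_⟩
    have := Finset.card_eq_sum_card_fiberwise (f := c) (s := Finset.univ) (t := Finset.univ)
      (fun _ _ => by simp)
    simp only [Finset.card_univ, Fintype.card_fin] at this
    refine Eq.trans ?_ this.symm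
    unfold fib
    congr!


lemma dcoef_pos (u : ℕ) : 0 < dcoef u := by unfold dcoef; positivity

lemma Enkt_lower_aux {ι : Type} [Fintype ι] (n k t : ℕ) (v : ι → ℕ) (hv : Function.Injective v)
    (hvt : ∀ i, v i ∈ Finset.Icc 1 t) (Q : ι → ℕ) (h1 : ∑ i, Q i = k)
    (h2 : ∑ i, v i * Q i = n) :
    (n.factorial : ℝ) * ∏ i, ((1 / dcoef (v i)) ^ (Q i) / ((Q i).factorial : ℝ))
      ≤ Enkt n k t := by
  have hE := Enkt_eq n k t
  have hkf : (0:ℝ) < k.factorial := by positivity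
  have hfibsum : ∀ (c : Fin k → ι) (g : ι → ℝ),
      ∏ j, g (c j) = ∏ i : ι, g i ^ (fib c i).card := by
    intro c g
    rw [← Finset.prod_fiberwise Finset.univ c]
    apply Finset.prod_congr rfl
    intro i _
    rw [Finset.prod_congr rfl (g := fun _ => g i)]
    · rw [Finset.prod_const]; rfl
    · intro j hj
      simp at hj
      rw [hj]
  have hfibsum' : ∀ (c : Fin k → ι),
      ∑ j, v (c j) = ∑ i : ι, v i * (fib c i).card := by
    intro c
    rw [← Finset.sum_fiberwise Finset.univ c]
    apply Finset.sum_congr rfl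
    intro i _
    rw [Finset.sum_congr rfl (g := fun _ => v i)]
    · rw [Finset.sum_const, smul_eq_mul, mul_comm]; rfl
    · intro j hj
      simp at hj
      rw [hj]
  set S := Finset.univ.filter fun c : Fin k → ι =>
      ∀ i, (fib c i).card = Q i with hS
  have hScard : S.card = Nat.multinomial Finset.univ Q := card_fib_eq' Q h1
  have hspec := Nat.multinomial_spec Finset.univ Q
  rw [h1, ← hScard] at hspec
  have hspec' := congrArg (Nat.cast (R := ℝ)) hspec
  push_cast at hspec'
  have hlow : (S.card : ℝ) * ∏ i : ι, (1 / dcoef (v i)) ^ Q i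
      ≤ ∑ m ∈ (Fintype.piFinset fun _ : Fin k => Finset.Icc 1 t).filter (fun m => ∑ i, m i = n),
        ∏ i, (1 / dcoef (m i)) := by
    have hinj : Function.Injective
        (fun (c : Fin k → ι) (j : Fin k) => v (c j)) := by
      intro c c' h
      funext j
      exact hv (congrFun h j)
    have hsub : S.image (fun c j => v (c j)) ⊆
        (Fintype.piFinset fun _ : Fin k => Finset.Icc 1 t).filter (fun m => ∑ i, m i = n) := by
      intro m hm
      simp only [Finset.mem_image, hS, Finset.mem_filter, Finset.mem_univ, true_and] at hm
      obtain ⟨c, hc, rfl⟩ := hm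
      simp only [Finset.mem_filter, Fintype.mem_piFinset]
      refine ⟨fun j => hvt (c j), ?_⟩
      rw [hfibsum' c, ← h2]
      exact Finset.sum_congr rfl fun i _ => by rw [hc i]
    refine le_trans ?_ (Finset.sum_le_sum_of_subset_of_nonneg hsub ?_)
    · rw [Finset.sum_image (fun a _ b _ h => hinj h)]
      rw [Finset.sum_congr rfl (g := fun _ => ∏ i : ι, (1 / dcoef (v i)) ^ Q i)]
      · simp
      · intro c hc
        simp only [hS, Finset.mem_filter, Finset.mem_univ, true_and] at hc
        rw [hfibsum c (fun u => 1 / dcoef (v u))]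
        exact Finset.prod_congr rfl fun i _ => by rw [hc i]
    · intro m _ _
      exact Finset.prod_nonneg fun i _ => by have := dcoef_pos (m i); positivity
  rw [← mul_le_mul_iff_left₀ hkf, hE, mul_assoc]
  refine mul_le_mul_of_nonneg_left (le_trans (le_of_eq ?_) hlow) (by positivity)
  rw [← hspec', Finset.prod_div_distrib]
  have : (∏ i : ι, ((Q i).factorial : ℝ)) ≠ 0 :=
    Finset.prod_ne_zero_iff.2 fun i _ => by positivity
  field_simp

lemma Enkt_lower (n k t : ℕ) (P : ℕ → ℕ) (h1 : ∑ u ∈ Finset.Icc 1 t, P u = k)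
    (h2 : ∑ u ∈ Finset.Icc 1 t, u * P u = n) :
    (n.factorial : ℝ) * ∏ u ∈ Finset.Icc 1 t, ((1 / dcoef u) ^ (P u) / ((P u).factorial : ℝ))
      ≤ Enkt n k t := by
  rw [← Finset.sum_coe_sort] at h1 h2
  rw [← Finset.prod_coe_sort]
  exact Enkt_lower_aux n k t (fun i : (Finset.Icc 1 t) => (i : ℕ)) Subtype.val_injective
    (fun i => i.2) (fun i => P i) h1 h2

lemma Enkt_upper (n k t : ℕ) (x : ℝ) (hx : 0 < x) :
    Enkt n k t * k.factorial * x ^ n ≤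
      n.factorial * (∑ u ∈ Finset.Icc 1 t, x ^ u / dcoef u) ^ k := by
  rw [Enkt_eq, mul_assoc]
  refine mul_le_mul_of_nonneg_left ?_ (by positivity)
  have : (∑ u ∈ Finset.Icc 1 t, x ^ u / dcoef u) ^ k
      = ∑ m ∈ (Fintype.piFinset fun _ : Fin k => Finset.Icc 1 t), ∏ i, (x ^ (m i) / dcoef (m i)) := by
    have h := Finset.prod_univ_sum (fun _ : Fin k => Finset.Icc 1 t)
      (fun _ u => x ^ u / dcoef u)
    rw [← h]
    simp
  rw [this, Finset.sum_mul]
  refine le_trans ?_ (Finset.sum_le_sum_of_subset_of_nonneg (Finset.filter_subset (fun m => ∑ i, m i = n) _) ?_)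
  · apply Finset.sum_le_sum
    intro m hm
    simp only [Finset.mem_filter] at hm
    apply le_of_eq
    rw [← hm.2, ← Finset.prod_pow_eq_pow_sum, ← Finset.prod_mul_distrib]
    apply Finset.prod_congr rfl
    intro i _
    ring
  · intro m _ _
    exact Finset.prod_nonneg fun i _ => by have := dcoef_pos (m i); positivity

lemma log_factorial_ge (n : ℕ) : (n:ℝ) * Real.log n - n ≤ Real.log n.factorial := by
  rcases Nat.eq_zero_or_pos n with rfl | hn
  · simp
  have h := Real.pow_div_factorial_le_exp (n:ℝ) (by positivity) n
  have hn' : (0:ℝ) < n := by exact_mod_cast hn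
  have hf : (0:ℝ) < n.factorial := by positivity
  have := Real.log_le_log (by positivity) h
  rw [Real.log_exp, Real.log_div (by positivity) (by positivity), Real.log_pow] at this
  linarith

lemma log_factorial_le (n : ℕ) (hn : 1 ≤ n) :
    Real.log n.factorial ≤ (n:ℝ) * Real.log n - n + 1 + Real.log n := by
  induction n, hn using Nat.le_induction with
  | base => simp
  | succ n hn ih =>
    have hn' : (0:ℝ) < n := by exact_mod_cast hn
    rw [Nat.factorial_succ, Nat.cast_mul, Real.log_mul (by positivity) (by positivity)]
    have h := Real.log_le_sub_one_of_pos (x := (n:ℝ)/(n+1)) (by positivity)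
    rw [Real.log_div (by positivity) (by positivity)] at h
    have h2 : ((n:ℝ)+1) * (Real.log n - Real.log (n+1)) ≤ -1 := by
      have : (n:ℝ)/(n+1) - 1 = -1/(n+1) := by field_simp; ring
      rw [this] at h
      have := mul_le_mul_of_nonneg_left h (by positivity : (0:ℝ) ≤ (n:ℝ)+1)
      rwa [mul_div_cancel₀ _ (by positivity : ((n:ℝ)+1) ≠ 0)] at this
    push_cast
    linarith

lemma exists_opt (n k t : ℕ) (ht : 2 ≤ t) (hk : 0 < k) (hkn : k < n) (hn : n < t * k) :
    ∃ A x : ℝ, 0 < A ∧ 0 < x ∧ (∑ u ∈ Finset.Icc 1 t, A * x ^ u / dcoef u = k) ∧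
      (∑ u ∈ Finset.Icc 1 t, (u:ℝ) * (A * x ^ u / dcoef u) = n) := by
  have hk' : (0:ℝ) < k := by exact_mod_cast hk
  set a : ℝ := n / k with ha
  have ha1 : 1 < a := by rw [ha, lt_div_iff₀ hk']; simpa using (by exact_mod_cast hkn)
  have hat : a < t := by rw [ha, div_lt_iff₀ hk']; exact_mod_cast hn
  let p : ℝ → ℝ := fun x => ∑ u ∈ Finset.Icc 1 t, ((u:ℝ) - a) * x ^ (u-1) / dcoef u
  have hp0 : p 0 < 0 := by
    show ∑ u ∈ Finset.Icc 1 t, ((u:ℝ) - a) * 0 ^ (u-1) / dcoef u < 0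
    rw [Finset.sum_eq_single 1]
    · simp [dcoef]; linarith
    · intro b hb hb1
      rw [Finset.mem_Icc] at hb
      have : b - 1 ≠ 0 := by omega
      simp [this]
    · intro h; exact absurd (Finset.mem_Icc.2 ⟨le_refl _, by omega⟩) h
  obtain ⟨y, hy0, hy⟩ : ∃ y : ℝ, 0 ≤ y ∧ 0 ≤ p y := by
    set B : ℝ := ∑ u ∈ Finset.Icc 1 (t-1), |(u:ℝ) - a| / dcoef u with hB
    have hBn : 0 ≤ B := Finset.sum_nonneg fun u _ => by have := dcoef_pos u; positivity
    have hdt := dcoef_pos t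
    refine ⟨1 + B * dcoef t / (t - a), by have : 0 < (t:ℝ) - a := by linarith
                                          positivity, ?_⟩
    set y : ℝ := 1 + B * dcoef t / (t - a) with hy
    have hta : 0 < (t:ℝ) - a := by linarith
    have hy1 : 1 ≤ y := by
      have : 0 ≤ B * dcoef t / (t - a) := by positivity
      linarith
    have hsplit : p y = ∑ u ∈ Finset.Icc 1 (t-1), ((u:ℝ) - a) * y ^ (u-1) / dcoef u
        + ((t:ℝ) - a) * y ^ (t-1) / dcoef t := by
      have : t = (t - 1) + 1 := by omega
      show ∑ u ∈ Finset.Icc 1 t, ((u:ℝ) - a) * y ^ (u-1) / dcoef u = _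
      conv_lhs => rw [this]
      rw [Finset.sum_Icc_succ_top (by omega)]
      rw [← this]
    have hlow : -(B * y ^ (t-2)) ≤ ∑ u ∈ Finset.Icc 1 (t-1), ((u:ℝ) - a) * y ^ (u-1) / dcoef u := by
      rw [hB, Finset.sum_mul, ← Finset.sum_neg_distrib]
      apply Finset.sum_le_sum
      intro u hu
      rw [Finset.mem_Icc] at hu
      have hd := dcoef_pos u
      have h1 : y ^ (u-1) ≤ y ^ (t-2) := pow_le_pow_right₀ hy1 (by omega)
      have h2 : 0 ≤ y ^ (u-1) := by positivity
      have h3 : -(|(u:ℝ) - a| * y^(t-2)) ≤ ((u:ℝ) - a) * y ^ (u-1) := by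
        have h4 := neg_abs_le ((u:ℝ) - a)
        have h5 := abs_nonneg ((u:ℝ) - a)
        nlinarith
      calc -(|(u:ℝ) - a| / dcoef u * y ^ (t-2)) = -(|(u:ℝ) - a| * y^(t-2)) / dcoef u := by ring
        _ ≤ _ := by gcongr
    rw [hsplit]
    have hpw : y ^ (t-1) = y ^ (t-2) * y := by rw [← pow_succ]; congr 1; omega
    have : B * y ^ (t-2) ≤ ((t:ℝ) - a) * y ^ (t-1) / dcoef t := by
      rw [le_div_iff₀ hdt, hpw]
      have : B * dcoef t ≤ ((t:ℝ) - a) * y := by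
        rw [hy, mul_add, mul_div_cancel₀ _ (by positivity)]
        linarith
      have h2 : 0 ≤ y ^ (t-2) := by positivity
      nlinarith
    linarith
  have hcont : Continuous p := by
    apply continuous_finsetSum
    intro u _
    fun_prop
  obtain ⟨x, hx, hpx⟩ := intermediate_value_Icc hy0 hcont.continuousOn ⟨hp0.le, hy⟩
  have hx0 : 0 < x := by
    rcases hx.1.lt_or_eq with h | h
    · exact h
    · rw [← h] at hpx; linarith
  set Z := ∑ u ∈ Finset.Icc 1 t, x ^ u / dcoef u with hZ
  have hZ0 : 0 < Z := Finset.sum_pos (fun u _ => by have := dcoef_pos u; positivity)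
    ⟨1, Finset.mem_Icc.2 ⟨le_refl _, by omega⟩⟩
  have hmean : ∑ u ∈ Finset.Icc 1 t, (u:ℝ) * (x ^ u / dcoef u) = a * Z := by
    have : ∑ u ∈ Finset.Icc 1 t, (u:ℝ) * (x ^ u / dcoef u) - a * Z = x * p x := by
      rw [hZ, Finset.mul_sum, ← Finset.sum_sub_distrib]
      show _ = x * ∑ u ∈ Finset.Icc 1 t, ((u:ℝ) - a) * x ^ (u-1) / dcoef u
      rw [Finset.mul_sum]
      apply Finset.sum_congr rfl
      intro u hu
      rw [Finset.mem_Icc] at hu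
      have : x ^ u = x * x ^ (u-1) := by rw [← pow_succ']; congr 1; omega
      rw [this]; ring
    rw [hpx, mul_zero] at this
    linarith
  refine ⟨k / Z, x, by positivity, hx0, ?_, ?_⟩
  · have : ∀ u ∈ Finset.Icc 1 t, k / Z * x ^ u / dcoef u = k / Z * (x ^ u / dcoef u) := by
      intro u _; ring
    rw [Finset.sum_congr rfl this, ← Finset.mul_sum, ← hZ]
    field_simp
  · have : ∀ u ∈ Finset.Icc 1 t, (u:ℝ) * (k / Z * x ^ u / dcoef u) =
        k / Z * ((u:ℝ) * (x ^ u / dcoef u)) := by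
      intro u _; ring
    rw [Finset.sum_congr rfl this, ← Finset.mul_sum, hmean, ha]
    field_simp

lemma log_f (A x : ℝ) (hA : 0 < A) (hx : 0 < x) (u : ℕ) :
    Real.log (A * x ^ u / dcoef u) = Real.log A + u * Real.log x - Real.log (dcoef u) := by
  have := dcoef_pos u
  rw [Real.log_div (by positivity) (by positivity), Real.log_mul (by positivity) (by positivity),
    Real.log_pow]

lemma L0_eq (n k t : ℕ) (A x : ℝ) (hA : 0 < A) (hx : 0 < x)
    (h1 : ∑ u ∈ Finset.Icc 1 t, A * x ^ u / dcoef u = k)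
    (h2 : ∑ u ∈ Finset.Icc 1 t, (u:ℝ) * (A * x ^ u / dcoef u) = n) :
    L0 n k t = n * Real.log n - n + k - k * Real.log A - n * Real.log x := by
  have hf0 : ∀ u, 0 < A * x ^ u / dcoef u := fun u => by have := dcoef_pos u; positivity
  have hfd : ∀ u, A * x ^ u / dcoef u * dcoef u = A * x ^ u := fun u => by
    have := dcoef_pos u; field_simp
  have hlfd : ∀ u : ℕ, Real.log (A * x ^ u) = Real.log A + u * Real.log x := fun u => by
    rw [Real.log_mul (by positivity) (by positivity), Real.log_pow]
  unfold L0
  apply IsGreatest.csSup_eq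
  constructor
  · refine ⟨fun u => A * x ^ u / dcoef u, fun u _ => (hf0 u).le, h1, h2, ?_⟩
    simp only [hfd, hlfd]
    have : ∑ u ∈ Finset.Icc 1 t, A * x ^ u / dcoef u * (Real.log A + u * Real.log x)
        = k * Real.log A + n * Real.log x := by
      rw [← h1, ← h2, Finset.sum_mul, Finset.sum_mul, ← Finset.sum_add_distrib]
      exact Finset.sum_congr rfl fun u _ => by ring
    rw [this]; ring
  · rintro y ⟨g, hg0, hg1, hg2, rfl⟩
    have key : ∀ u ∈ Finset.Icc 1 t, g u * (Real.log A + u * Real.log x) + g u - A * x ^ u / dcoef u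
        ≤ g u * Real.log (g u * dcoef u) := by
      intro u hu
      rcases (hg0 u hu).lt_or_eq with h | h
      · have hd := dcoef_pos u
        have hl := Real.log_le_sub_one_of_pos (x := (A * x ^ u / dcoef u) / g u) (by positivity)
        rw [Real.log_div (hf0 u).ne' h.ne', log_f A x hA hx] at hl
        rw [Real.log_mul h.ne' hd.ne']
        have := mul_le_mul_of_nonneg_left hl h.le
        have e : g u * ((A * x ^ u / dcoef u) / g u - 1) = A * x ^ u / dcoef u - g u := by
          field_simp
        rw [e] at this
        linarith
      · rw [← h]; simp; exact (hf0 u).le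
    have hs := Finset.sum_le_sum key
    have e : ∑ u ∈ Finset.Icc 1 t, (g u * (Real.log A + u * Real.log x) + g u - A * x ^ u / dcoef u)
        = k * Real.log A + n * Real.log x := by
      have e1 : ∑ u ∈ Finset.Icc 1 t, (g u * (Real.log A + u * Real.log x))
        = k * Real.log A + n * Real.log x := by
        rw [← hg1, ← hg2, Finset.sum_mul, Finset.sum_mul, ← Finset.sum_add_distrib]
        exact Finset.sum_congr rfl fun u _ => by ring
      rw [Finset.sum_sub_distrib, Finset.sum_add_distrib, h1, hg1, e1]; ring
    rw [e] at hs
    linarith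

lemma logE_upper (n k t : ℕ) (A x : ℝ) (hA : 0 < A) (hx : 0 < x) (hk : 0 < k) (hn : 0 < n)
    (h1 : ∑ u ∈ Finset.Icc 1 t, A * x ^ u / dcoef u = k)
    (h2 : ∑ u ∈ Finset.Icc 1 t, (u:ℝ) * (A * x ^ u / dcoef u) = n) (hE : 0 < Enkt n k t) :
    Real.log (Enkt n k t) ≤ L0 n k t + 1 + Real.log n := by
  have hk' : (0:ℝ) < k := by exact_mod_cast hk
  have hZ : ∑ u ∈ Finset.Icc 1 t, x ^ u / dcoef u = k / A := by
    rw [← h1, Finset.sum_div]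
    exact Finset.sum_congr rfl fun u _ => by field_simp
  have h := Enkt_upper n k t x hx
  rw [hZ] at h
  have hl := Real.log_le_log (by positivity) h
  rw [Real.log_mul (by positivity) (by positivity), Real.log_mul (by positivity) (by positivity),
    Real.log_mul (by positivity) (by positivity), Real.log_pow, Real.log_pow,
    Real.log_div (by positivity) (by positivity)] at hl
  rw [L0_eq n k t A x hA hx h1 h2]
  have a1 := log_factorial_ge k
  have a2 := log_factorial_le n hn
  linarith

lemma E_pos (n k t : ℕ) (P : ℕ → ℕ)
    (hP1 : ∑ u ∈ Finset.Icc 1 t, P u = k) (hP2 : ∑ u ∈ Finset.Icc 1 t, u * P u = n) :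
    0 < Enkt n k t :=
  lt_of_lt_of_le (mul_pos (by positivity) (Finset.prod_pos fun u _ => by
    have := dcoef_pos u; positivity)) (Enkt_lower n k t P hP1 hP2)

lemma logE_lower (n k t : ℕ) (A x : ℝ) (hA : 0 < A) (hx : 0 < x)
    (h1 : ∑ u ∈ Finset.Icc 1 t, A * x ^ u / dcoef u = k)
    (h2 : ∑ u ∈ Finset.Icc 1 t, (u:ℝ) * (A * x ^ u / dcoef u) = n) (P : ℕ → ℕ)
    (hP1 : ∑ u ∈ Finset.Icc 1 t, P u = k) (hP2 : ∑ u ∈ Finset.Icc 1 t, u * P u = n) :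
    L0 n k t + ∑ u ∈ Finset.Icc 1 t, (P u * Real.log (A * x ^ u / dcoef u) - A * x ^ u / dcoef u
      - Real.log (P u).factorial) ≤ Real.log (Enkt n k t) := by
  have h := Enkt_lower n k t P hP1 hP2
  have hpos : ∀ u ∈ Finset.Icc 1 t, (1 / dcoef u) ^ (P u) / ((P u).factorial : ℝ) ≠ 0 := by
    intro u _
    have := dcoef_pos u; positivity
  have hl := Real.log_le_log (mul_pos (by positivity) (Finset.prod_pos fun u _ => by
    have := dcoef_pos u; positivity)) h
  rw [Real.log_mul (by positivity) (Finset.prod_ne_zero_iff.2 hpos), Real.log_prod hpos] at hl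
  refine le_trans ?_ hl
  rw [L0_eq n k t A x hA hx h1 h2]
  have hn := log_factorial_ge n
  have e : ∀ u, Real.log ((1 / dcoef u) ^ (P u) / ((P u).factorial : ℝ)) =
      - P u * Real.log (dcoef u) - Real.log (P u).factorial := by
    intro u
    have := dcoef_pos u
    rw [Real.log_div (by positivity) (by positivity), Real.log_pow, one_div, Real.log_inv]
    ring
  simp only [e, log_f A x hA hx]
  have e2 : ∑ u ∈ Finset.Icc 1 t, (P u * (Real.log A + u * Real.log x - Real.log (dcoef u))
      - A * x ^ u / dcoef u - Real.log (P u).factorial)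
      = k * Real.log A + n * Real.log x - k + ∑ u ∈ Finset.Icc 1 t,
        (- P u * Real.log (dcoef u) - Real.log (P u).factorial) := by
    have hP1' : ∑ u ∈ Finset.Icc 1 t, (P u : ℝ) = k := by exact_mod_cast hP1
    have hP2' : ∑ u ∈ Finset.Icc 1 t, (u:ℝ) * (P u : ℝ) = n := by exact_mod_cast hP2
    have e3 : ∀ u ∈ Finset.Icc 1 t, (P u * (Real.log A + u * Real.log x - Real.log (dcoef u))
      - A * x ^ u / dcoef u - Real.log (P u).factorial) =
        (P u : ℝ) * Real.log A + ((u:ℝ) * (P u : ℝ)) * Real.log x - A * x ^ u / dcoef u +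
        (- P u * Real.log (dcoef u) - Real.log (P u).factorial) := by
      intro u _; ring
    rw [Finset.sum_congr rfl e3, Finset.sum_add_distrib, Finset.sum_sub_distrib, h1,
      Finset.sum_add_distrib, ← Finset.sum_mul, ← Finset.sum_mul, hP1', hP2']
  rw [e2]
  linarith

lemma poisson_cost (f : ℝ) (P : ℕ) (hf : 0 < f) (hP : 1 ≤ P) :
    -(f - P)^2 / f - 1 - Real.log P ≤ P * Real.log f - f - Real.log P.factorial := by
  have hP' : (0:ℝ) < P := by exact_mod_cast hP
  have h := log_factorial_le P hP
  have hl := Real.log_le_sub_one_of_pos (x := (P:ℝ) / f) (by positivity)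
  rw [Real.log_div (by positivity) (by positivity)] at hl
  have := mul_le_mul_of_nonneg_left hl hP'.le
  have e : -(f - P)^2 / f = -(P * (P / f - 1)) - f + P := by field_simp; ring
  rw [e]
  linarith


lemma ratio_analysis (t M : ℕ) (F R : ℕ → ℝ) (K c₁ c₂ : ℝ) (hK : 0 < K) (hc2 : 0 < c₂)
    (hM : 2 * c₂ ≤ M) (hMt : M < t)
    (hF : ∀ j, 0 < F j) (hR : ∀ j, j < t → 0 < R j)
    (hFR : ∀ j, j + 1 < t → F (j+1) = R j * F j)
    (hR1 : ∀ j, j + 1 < t → R (j+1) ≤ R j / 2)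
    (hR2 : ∀ j, j + 1 < t → R j / 4 ≤ R (j+1))
    (hsum : ∑ j ∈ Finset.range t, F j = K)
    (h1 : c₁ * K ≤ ∑ j ∈ Finset.range t, (j:ℝ) * F j)
    (h2 : ∑ j ∈ Finset.range t, (j:ℝ) * F j ≤ c₂ * K) :
    c₁ ≤ R 0 ∧ R 0 ≤ 4 ^ M * (2 * c₂) ∧ K ≤ 2 * M * (1 + 4 ^ M * (2 * c₂)) ^ M * F 0 ∧
      ∀ j, j < t → F j * 2 ^ (j.choose 2) ≤ F 0 * R 0 ^ j := by
  have ht0 : 0 < t := by omega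
  have hr := hR 0 ht0
  have hup : ∀ j, j < t → R j ≤ R 0 / 2 ^ j := by
    intro j
    induction j with
    | zero => intro _; simp
    | succ j ih =>
      intro hj
      calc R (j+1) ≤ R j / 2 := hR1 j hj
        _ ≤ (R 0 / 2 ^ j) / 2 := by have := ih (by omega); linarith
        _ = _ := by rw [pow_succ, div_div]
  have hlo : ∀ j, j < t → R 0 / 4 ^ j ≤ R j := by
    intro j
    induction j with
    | zero => intro _; simp
    | succ j ih =>
      intro hj
      calc R 0 / 4 ^ (j+1) = (R 0 / 4 ^ j) / 4 := by rw [pow_succ, div_div]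
        _ ≤ R j / 4 := by have := ih (by omega); linarith
        _ ≤ _ := hR2 j hj
  have hFj : ∀ j, j < t → F j * 2 ^ (j.choose 2) ≤ F 0 * R 0 ^ j := by
    intro j
    induction j with
    | zero => intro _; simp
    | succ j ih =>
      intro hj
      have e : (j+1).choose 2 = j.choose 2 + j := by
        rw [Nat.choose_succ_succ' j 1]; simp; ring
      rw [hFR j hj, e, pow_add, pow_succ]
      have a1 := ih (by omega)
      have a2 := hup j (by omega)
      rw [le_div_iff₀ (by positivity)] at a2
      have a3 := hR j (by omega)
      calc R j * F j * (2 ^ j.choose 2 * 2 ^ j) = (F j * 2 ^ j.choose 2) * (R j * 2 ^ j) := by ring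
        _ ≤ (F 0 * R 0 ^ j) * R 0 := by
          apply mul_le_mul a1 a2 (by positivity)
          have := hF 0
          positivity
        _ = _ := by ring
  have hc1 : c₁ ≤ R 0 := by
    obtain ⟨s, rfl⟩ : ∃ s, t = s + 1 := ⟨t - 1, by omega⟩
    have : ∑ j ∈ Finset.range (s+1), (j:ℝ) * F j ≤ R 0 * K := by
      rw [Finset.sum_range_succ']
      simp only [Nat.cast_zero, zero_mul, add_zero]
      calc ∑ j ∈ Finset.range s, ((j+1 : ℕ):ℝ) * F (j+1)
          ≤ ∑ j ∈ Finset.range s, R 0 * F j := by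
            apply Finset.sum_le_sum
            intro j hj
            rw [Finset.mem_range] at hj
            rw [hFR j (by omega)]
            have a2 := hup j (by omega)
            have a4 : ((j+1 : ℕ):ℝ) ≤ 2 ^ j := by exact_mod_cast Nat.lt_two_pow_self
            have a5 : ((j+1 : ℕ):ℝ) * R j ≤ R 0 := by
              rw [le_div_iff₀ (by positivity)] at a2
              have := hR j (by omega)
              nlinarith
            have := hF j
            nlinarith
        _ ≤ R 0 * K := by
          rw [← Finset.mul_sum, ← hsum]
          apply mul_le_mul_of_nonneg_left _ hr.le
          rw [Finset.sum_range_succ]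
          have := hF s
          linarith
    exact le_of_mul_le_mul_right (h1.trans this) hK
  have hMpos : (0:ℝ) < M := by linarith
  have hsplit : ∀ g : ℕ → ℝ, ∑ j ∈ Finset.range t, g j
      = ∑ j ∈ Finset.range M, g j + ∑ j ∈ Finset.Ico M t, g j := by
    intro g
    rw [Finset.sum_range_add_sum_Ico _ hMt.le]
  have htail : ∑ j ∈ Finset.Ico M t, F j ≤ K / 2 := by
    have a1 : (M:ℝ) * ∑ j ∈ Finset.Ico M t, F j ≤ c₂ * K := by
      rw [Finset.mul_sum]
      refine le_trans ?_ h2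
      rw [hsplit]
      have b1 : 0 ≤ ∑ j ∈ Finset.range M, (j:ℝ) * F j :=
        Finset.sum_nonneg fun j _ => by have := hF j; positivity
      have b2 : ∑ j ∈ Finset.Ico M t, (M:ℝ) * F j ≤ ∑ j ∈ Finset.Ico M t, (j:ℝ) * F j := by
        apply Finset.sum_le_sum
        intro j hj
        rw [Finset.mem_Ico] at hj
        have := hF j
        have : (M:ℝ) ≤ j := by exact_mod_cast hj.1
        gcongr
      linarith
    have a0 : 0 ≤ ∑ j ∈ Finset.Ico M t, F j := Finset.sum_nonneg fun j _ => (hF j).le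
    have a2 : 2 * c₂ * ∑ j ∈ Finset.Ico M t, F j ≤ c₂ * K :=
      le_trans (mul_le_mul_of_nonneg_right hM a0) a1
    have a3 : c₂ * (2 * ∑ j ∈ Finset.Ico M t, F j) ≤ c₂ * K := by linarith
    have := le_of_mul_le_mul_left a3 hc2
    linarith
  have hhead : K / 2 ≤ ∑ j ∈ Finset.range M, F j := by
    have := hsplit F
    linarith
  have hrb : R 0 ≤ 4 ^ M * (2 * c₂) := by
    have a1 : (R 0 / 4 ^ M) * ∑ j ∈ Finset.range M, F j ≤ c₂ * K := by
      rw [Finset.mul_sum]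
      calc ∑ j ∈ Finset.range M, R 0 / 4 ^ M * F j
          ≤ ∑ j ∈ Finset.range M, ((j+1 : ℕ):ℝ) * F (j+1) := by
            apply Finset.sum_le_sum
            intro j hj
            rw [Finset.mem_range] at hj
            rw [hFR j (by omega)]
            have b1 := hlo j (by omega)
            have b2 : R 0 / 4 ^ M ≤ R 0 / 4 ^ j := by
              apply div_le_div_of_nonneg_left hr.le (by positivity)
              exact pow_le_pow_right₀ (by norm_num) hj.le
            have b3 := hF j
            have b4 : R 0 / 4 ^ M * F j ≤ R j * F j :=
              mul_le_mul_of_nonneg_right (b2.trans b1) b3.le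
            have b5 : (1:ℝ) ≤ ((j+1 : ℕ):ℝ) := by push_cast; linarith [(Nat.cast_nonneg j : (0:ℝ) ≤ j)]
            have b6 : 0 < R j * F j := mul_pos (hR j (by omega)) b3
            nlinarith
        _ = ∑ j ∈ Finset.range (M+1), (j:ℝ) * F j := by
            rw [Finset.sum_range_succ']; simp
        _ ≤ ∑ j ∈ Finset.range t, (j:ℝ) * F j := by
            apply Finset.sum_le_sum_of_subset_of_nonneg
            · exact Finset.range_subset_range.2 (by omega)
            · intro j _ _; have := hF j; positivity
        _ ≤ c₂ * K := h2
    have a2 : (R 0 / 4 ^ M) * (K / 2) ≤ c₂ * K :=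
      le_trans (mul_le_mul_of_nonneg_left hhead (by positivity)) a1
    have a3 : (R 0 / 4 ^ M) * K ≤ (2 * c₂) * K := by linarith
    have a4 := le_of_mul_le_mul_right a3 hK
    rw [div_le_iff₀ (by positivity)] at a4
    linarith
  refine ⟨hc1, hrb, ?_, hFj⟩
  have a1 : ∑ j ∈ Finset.range M, F j ≤ ∑ j ∈ Finset.range M, (1 + 4 ^ M * (2 * c₂)) ^ M * F 0 := by
    apply Finset.sum_le_sum
    intro j hj
    rw [Finset.mem_range] at hj
    have b1 := hFj j (by omega)
    have b2 : F j ≤ F j * 2 ^ (j.choose 2) :=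
      le_mul_of_one_le_right (hF j).le (one_le_pow₀ (by norm_num))
    have b3 : R 0 ^ j ≤ (1 + 4 ^ M * (2 * c₂)) ^ M := by
      calc R 0 ^ j ≤ (1 + 4 ^ M * (2 * c₂)) ^ j := by
            apply pow_le_pow_left₀ hr.le; linarith
        _ ≤ _ := by
          apply pow_le_pow_right₀ _ hj.le
          have : 0 < 4 ^ M * (2 * c₂) := by positivity
          linarith
    have := hF 0
    nlinarith
  rw [Finset.sum_const, Finset.card_range, nsmul_eq_mul] at a1
  linarith

lemma sum_reflect {β : Type*} [AddCommMonoid β] (t : ℕ) (g : ℕ → β) :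
    ∑ u ∈ Finset.Icc 1 t, g u = ∑ j ∈ Finset.range t, g (t - j) := by
  apply Finset.sum_nbij' (fun u => t - u) (fun j => t - j)
  · intro u hu; simp at hu ⊢; omega
  · intro j hj; simp at hj ⊢; omega
  · intro u hu; simp at hu ⊢; omega
  · intro j hj; simp at hj ⊢; omega
  · intro u hu; simp at hu ⊢; congr 1; omega

lemma profile_exists (n k t J : ℕ) (F : ℕ → ℝ) (hF : ∀ j, 0 < F j) (ht : 2 ≤ t) (hJ : 2 ≤ J)
    (hkn : k ≤ n)
    (h1 : ∑ j ∈ Finset.range t, F j = k)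
    (h2 : ∑ j ∈ Finset.range t, ((t - j : ℕ):ℝ) * F j = n)
    (hF0 : (t:ℝ)^4 ≤ F 0) (hF1 : (t:ℝ)^4 ≤ F 1) (hFJ : ∀ j, j < t → J ≤ j → F j < 1) :
    ∃ p : ℕ → ℕ, ∑ j ∈ Finset.range t, p j = k ∧ ∑ j ∈ Finset.range t, (t - j) * p j = n ∧
      ∀ j ∈ Finset.range t, -2 - (if j < J then Real.log n else 0) ≤
        p j * Real.log (F j) - F j - Real.log (p j).factorial := by
  have ht' : (2:ℝ) ≤ t := by exact_mod_cast ht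
  have hsplit : ∀ g : ℕ → ℝ, ∑ j ∈ Finset.range t, g j
      = g 0 + g 1 + ∑ j ∈ Finset.Ico 2 t, g j := by
    intro g
    rw [← Finset.sum_range_add_sum_Ico _ ht, Finset.sum_range_succ, Finset.sum_range_one]
  have hsplitN : ∀ g : ℕ → ℕ, ∑ j ∈ Finset.range t, g j
      = g 0 + g 1 + ∑ j ∈ Finset.Ico 2 t, g j := by
    intro g
    rw [← Finset.sum_range_add_sum_Ico _ ht, Finset.sum_range_succ, Finset.sum_range_one]
  have h3 : ∑ j ∈ Finset.range t, (j:ℝ) * F j = t * k - n := by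
    rw [← h1, ← h2, Finset.mul_sum, ← Finset.sum_sub_distrib]
    apply Finset.sum_congr rfl
    intro j hj
    rw [Finset.mem_range] at hj
    rw [Nat.cast_sub hj.le]; ring
  rw [hsplit] at h1 h3
  simp only [Nat.cast_zero, zero_mul, zero_add, Nat.cast_one, one_mul] at h3
  set N2 : ℕ := ∑ j ∈ Finset.Ico 2 t, ⌊F j⌋₊ with hN2
  set M2 : ℕ := ∑ j ∈ Finset.Ico 2 t, j * ⌊F j⌋₊ with hM2
  have hfl : ∀ j, (⌊F j⌋₊ : ℝ) ≤ F j := fun j => Nat.floor_le (hF j).le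
  have hfl' : ∀ j, F j ≤ ⌊F j⌋₊ + 1 := fun j => (Nat.lt_floor_add_one (F j)).le
  have hN2a : (N2:ℝ) ≤ ∑ j ∈ Finset.Ico 2 t, F j := by
    rw [hN2]; push_cast; exact Finset.sum_le_sum fun j _ => hfl j
  have hcard : ((Finset.Ico 2 t).card : ℝ) ≤ t := by
    rw [Nat.card_Ico]; exact_mod_cast Nat.sub_le _ _
  have hN2b : ∑ j ∈ Finset.Ico 2 t, F j ≤ N2 + t := by
    have : ∑ j ∈ Finset.Ico 2 t, F j ≤ ∑ j ∈ Finset.Ico 2 t, ((⌊F j⌋₊ : ℝ) + 1) :=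
      Finset.sum_le_sum fun j _ => hfl' j
    rw [Finset.sum_add_distrib, Finset.sum_const, nsmul_eq_mul, mul_one] at this
    rw [hN2]; push_cast; linarith
  have hM2a : (M2:ℝ) ≤ ∑ j ∈ Finset.Ico 2 t, (j:ℝ) * F j := by
    rw [hM2]; push_cast
    exact Finset.sum_le_sum fun j _ => mul_le_mul_of_nonneg_left (hfl j) (by positivity)
  have hM2b : ∑ j ∈ Finset.Ico 2 t, (j:ℝ) * F j ≤ M2 + t * t := by
    have : ∑ j ∈ Finset.Ico 2 t, (j:ℝ) * F j
        ≤ ∑ j ∈ Finset.Ico 2 t, ((j:ℝ) * (⌊F j⌋₊ : ℝ) + t) := by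
      apply Finset.sum_le_sum
      intro j hj
      rw [Finset.mem_Ico] at hj
      have b1 : (j:ℝ) ≤ t := by exact_mod_cast hj.2.le
      have b2 := mul_le_mul_of_nonneg_left (hfl' j) (by positivity : (0:ℝ) ≤ j)
      linarith
    rw [Finset.sum_add_distrib, Finset.sum_const, nsmul_eq_mul] at this
    rw [hM2]; push_cast
    have : ((Finset.Ico 2 t).card : ℝ) * t ≤ t * t := by gcongr
    linarith
  have ht2 : (t:ℝ)*t + 1 ≤ (t:ℝ)^4 := by
    have : (4:ℝ) ≤ (t:ℝ)*t := by nlinarith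
    have e : (t:ℝ)^4 = (t*t)*(t*t) := by ring
    rw [e]; nlinarith
  have hF1' : 0 < F 1 := hF 1
  obtain ⟨p1, hp1⟩ : ∃ p1 : ℕ, p1 + (n + M2) = t * k := by
    have : n + M2 ≤ t * k := by
      have : (n:ℝ) + M2 ≤ t * k := by linarith
      exact_mod_cast this
    exact ⟨t * k - (n + M2), by omega⟩
  have hp1' : (p1:ℝ) + (n + M2) = t * k := by exact_mod_cast hp1
  have htt : (t:ℝ) ≤ t * t := by nlinarith
  obtain ⟨p0, hp0⟩ : ∃ p0 : ℕ, p0 + (p1 + N2) = k := by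
    have : p1 + N2 ≤ k := by
      have : (p1:ℝ) + N2 ≤ k := by linarith
      exact_mod_cast this
    exact ⟨k - (p1 + N2), by omega⟩
  have hp0' : (p0:ℝ) + (p1 + N2) = k := by exact_mod_cast hp0
  let p : ℕ → ℕ := fun j => if j = 0 then p0 else if j = 1 then p1 else ⌊F j⌋₊
  have hpIco : ∀ j ∈ Finset.Ico 2 t, p j = ⌊F j⌋₊ := by
    intro j hj
    rw [Finset.mem_Ico] at hj
    have e0 : j ≠ 0 := by omega
    have e1 : j ≠ 1 := by omega
    simp [p, e0, e1]
  have hsp : ∑ j ∈ Finset.range t, p j = k := by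
    rw [hsplitN, Finset.sum_congr rfl hpIco]
    show p0 + p1 + N2 = k
    omega
  have hsp2 : ∑ j ∈ Finset.range t, (t - j) * p j = n := by
    have a : ∑ j ∈ Finset.range t, (t - j) * p j + ∑ j ∈ Finset.range t, j * p j = t * k := by
      rw [← Finset.sum_add_distrib, ← hsp, Finset.mul_sum]
      apply Finset.sum_congr rfl
      intro j hj
      rw [Finset.mem_range] at hj
      rw [← add_mul]; congr 1; omega
    have b : ∑ j ∈ Finset.range t, j * p j = p1 + M2 := by
      rw [hsplitN, hM2, Finset.sum_congr rfl (fun j hj => by rw [hpIco j hj])]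
      show 0 * p0 + 1 * p1 + _ = _
      ring
    omega
  have hpk : ∀ j ∈ Finset.range t, p j ≤ n := by
    intro j hj
    have : p j ≤ ∑ j ∈ Finset.range t, p j := Finset.single_le_sum (f := p) (fun _ _ => Nat.zero_le _) hj
    omega
  have main : ∀ j ∈ Finset.range t, j < J → 1 ≤ p j → (F j - p j)^2 ≤ F j →
      -2 - (if j < J then Real.log n else 0) ≤
        p j * Real.log (F j) - F j - Real.log (p j).factorial := by
    intro j hj hjJ hp hd
    refine le_trans ?_ (poisson_cost (F j) (p j) (hF j) hp)
    rw [if_pos hjJ]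
    have b1 : Real.log (p j) ≤ Real.log n :=
      Real.log_le_log (by exact_mod_cast hp) (by exact_mod_cast hpk j hj)
    have b2 : (F j - p j)^2 / F j ≤ 1 := by rw [div_le_one (hF j)]; exact hd
    rw [neg_div]
    linarith
  have hsq : ∀ d : ℝ, -(t*t:ℝ) ≤ d → d ≤ t * t → d^2 ≤ (t:ℝ)^4 := by
    intro d hd1 hd2
    have e : (t:ℝ)^4 = (t*t)^2 := by ring
    rw [e]
    exact sq_le_sq' hd1 hd2
  refine ⟨p, hsp, hsp2, ?_⟩
  intro j hj
  rcases Nat.lt_or_ge j 2 with hj2 | hj2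
  · interval_cases j
    · have e : p 0 = p0 := rfl
      apply main 0 hj (by omega)
      · rw [e]
        have : (0:ℝ) < p0 := by linarith
        exact_mod_cast this
      · rw [e]; exact le_trans (hsq _ (by linarith) (by linarith)) hF0
    · have e : p 1 = p1 := rfl
      apply main 1 hj (by omega)
      · rw [e]
        have : (0:ℝ) < p1 := by linarith
        exact_mod_cast this
      · rw [e]; exact le_trans (hsq _ (by linarith) (by linarith)) hF1
  · have e := hpIco j (Finset.mem_Ico.2 ⟨hj2, Finset.mem_range.1 hj⟩)
    rcases lt_or_ge (F j) 1 with h | h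
    · rw [e, Nat.floor_eq_zero.2 h]
      simp
      have : 0 ≤ (if j < J then Real.log n else 0) := by
        split_ifs
        · exact Real.log_natCast_nonneg n
        · exact le_refl _
      linarith
    · have hjJ : j < J := by
        by_contra hc
        exact absurd (hFJ j (Finset.mem_range.1 hj) (by omega)) (by linarith)
      apply main j hj hjJ
      · rw [e]; exact Nat.one_le_floor_iff _ |>.2 h
      · rw [e]
        have b1 := hfl j
        have b2 := hfl' j
        have d0 : 0 ≤ F j - ⌊F j⌋₊ := by linarith
        have d1 : F j - ⌊F j⌋₊ ≤ 1 := by linarith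
        calc (F j - ⌊F j⌋₊)^2 ≤ (1:ℝ)^2 := pow_le_pow_left₀ d0 d1 2
          _ ≤ F j := by linarith


lemma dcoef_succ (u : ℕ) : dcoef (u + 1) = dcoef u * (2 ^ u * ((u:ℝ) + 1)) := by
  unfold dcoef
  rw [Nat.choose_succ_succ' u 1, Nat.choose_one_right, pow_add, Nat.factorial_succ]
  push_cast
  ring

lemma det_bound (n k t M J : ℕ) (c₁ c₂ : ℝ) (hc1 : 0 < c₁) (hc2 : 0 < c₂)
    (hM : 2 * c₂ ≤ M) (hMt : M < t) (ht : 2 ≤ t) (hk : 0 < k) (hkn : k < n)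
    (h1 : c₁ * k ≤ t * k - n) (h2 : (t:ℝ) * k - n ≤ c₂ * k)
    (hl1 : (t:ℝ) ^ 4 * (2 * M * (1 + 4 ^ M * (2 * c₂)) ^ M) ≤ k)
    (hl2 : (t:ℝ) ^ 4 * (2 * M * (1 + 4 ^ M * (2 * c₂)) ^ M) ≤ c₁ * k)
    (hJ : 2 ≤ J)
    (hJ2 : ∀ j, J ≤ j → (n:ℝ) * (1 + 4 ^ M * (2 * c₂)) ^ j < 2 ^ (j.choose 2)) :
    Real.log (Enkt n k t) ≤ L0 n k t + 1 + Real.log n ∧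
      L0 n k t - (2 * t + J * Real.log n) ≤ Real.log (Enkt n k t) := by
  have hk' : (0:ℝ) < k := by exact_mod_cast hk
  have hntk : n < t * k := by
    have : (n:ℝ) < (t * k : ℕ) := by
      push_cast
      have : 0 < c₁ * k := by positivity
      linarith
    exact_mod_cast this
  obtain ⟨A, x, hA, hx, hs1, hs2⟩ := exists_opt n k t ht hk hkn hntk
  set F : ℕ → ℝ := fun j => A * x ^ (t - j) / dcoef (t - j) with hFdef
  set R : ℕ → ℝ := fun j => 2 ^ (t - 1 - j) * (((t - 1 - j : ℕ):ℝ) + 1) / x with hRdef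
  have hF : ∀ j, 0 < F j := fun j => by
    have := dcoef_pos (t - j)
    simp only [hFdef]; positivity
  have hR : ∀ j, 0 < R j := fun j => by
    simp only [hRdef]; positivity
  have hFR : ∀ j, j + 1 < t → F (j+1) = R j * F j := by
    intro j hj
    obtain ⟨u, hu⟩ : ∃ u, t = u + 1 + j := ⟨t - 1 - j, by omega⟩
    have e1 : t - (j + 1) = u := by omega
    have e2 : t - j = u + 1 := by omega
    have e3 : t - 1 - j = u := by omega
    simp only [hFdef, hRdef, e1, e2, e3, dcoef_succ]
    have := dcoef_pos u
    rw [pow_succ]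
    field_simp
  have hR1 : ∀ j, j + 1 < t → R (j+1) ≤ R j / 2 := by
    intro j hj
    obtain ⟨u, hu⟩ : ∃ u, t = u + 2 + j := ⟨t - 2 - j, by omega⟩
    have e1 : t - 1 - (j + 1) = u := by omega
    have e3 : t - 1 - j = u + 1 := by omega
    simp only [hRdef, e1, e3]
    push_cast
    have : (2:ℝ) ^ (u+1) * ((u:ℝ) + 1 + 1) / x / 2 - 2 ^ u * ((u:ℝ) + 1) / x = 2 ^ u / x := by
      rw [pow_succ]; field_simp; ring
    have : 0 < (2:ℝ) ^ u / x := by positivity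
    linarith
  have hR2 : ∀ j, j + 1 < t → R j / 4 ≤ R (j+1) := by
    intro j hj
    obtain ⟨u, hu⟩ : ∃ u, t = u + 2 + j := ⟨t - 2 - j, by omega⟩
    have e1 : t - 1 - (j + 1) = u := by omega
    have e3 : t - 1 - j = u + 1 := by omega
    simp only [hRdef, e1, e3]
    push_cast
    have : 2 ^ u * ((u:ℝ) + 1) / x - (2:ℝ) ^ (u+1) * ((u:ℝ) + 1 + 1) / x / 4
        = 2 ^ u * u / x / 2 := by
      rw [pow_succ]; field_simp; ring
    have : 0 ≤ (2:ℝ) ^ u * u / x / 2 := by positivity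
    linarith
  have hsum : ∑ j ∈ Finset.range t, F j = k := by
    rw [← hs1, sum_reflect]
  have hsum2 : ∑ j ∈ Finset.range t, ((t - j : ℕ):ℝ) * F j = n := by
    rw [← hs2, sum_reflect]
  have hdef : ∑ j ∈ Finset.range t, (j:ℝ) * F j = t * k - n := by
    rw [← hsum, ← hsum2, Finset.mul_sum, ← Finset.sum_sub_distrib]
    refine Finset.sum_congr rfl fun j hj => ?_
    rw [Nat.cast_sub (Finset.mem_range.1 hj).le]
    ring
  obtain ⟨r1, r2, r3, r4⟩ := ratio_analysis t M F R k c₁ c₂ hk' hc2 hM hMt hF (fun j _ => hR j)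
    hFR hR1 hR2 hsum (by rw [hdef]; exact h1) (by rw [hdef]; exact h2)
  set b : ℝ := 4 ^ M * (2 * c₂) with hb
  have hb0 : 0 < b := by positivity
  have hM0 : (0:ℝ) < M := by linarith
  set D : ℝ := 2 * M * (1 + b) ^ M with hD
  have hD0 : 0 < D := by positivity
  have hF0 : (t:ℝ)^4 ≤ F 0 := by
    have : (t:ℝ)^4 * D ≤ F 0 * D := by linarith
    exact le_of_mul_le_mul_right this hD0
  have hF1 : (t:ℝ)^4 ≤ F 1 := by
    have e : F 1 = R 0 * F 0 := hFR 0 (by omega)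
    have a1 : c₁ * F 0 ≤ F 1 := by
      rw [e]; exact mul_le_mul_of_nonneg_right r1 (hF 0).le
    have a2 : c₁ * k ≤ c₁ * (D * F 0) := mul_le_mul_of_nonneg_left r3 hc1.le
    have a3 : c₁ * F 0 * D ≤ F 1 * D := mul_le_mul_of_nonneg_right a1 hD0.le
    have : (t:ℝ)^4 * D ≤ F 1 * D := by linarith
    exact le_of_mul_le_mul_right this hD0
  have hF0k : F 0 ≤ n := by
    have : F 0 ≤ ∑ j ∈ Finset.range t, F j :=
      Finset.single_le_sum (f := F) (fun j _ => (hF j).le) (Finset.mem_range.2 (by omega))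
    have hkn' : (k:ℝ) ≤ n := by exact_mod_cast hkn.le
    linarith
  have hFJ : ∀ j, j < t → J ≤ j → F j < 1 := by
    intro j hj hJj
    have a1 := r4 j hj
    have a2 : F 0 * R 0 ^ j ≤ n * (1 + b) ^ j := by
      apply mul_le_mul hF0k _ (pow_nonneg (hR 0).le _) (by positivity)
      exact pow_le_pow_left₀ (hR 0).le (by linarith) j
    have a3 := hJ2 j hJj
    have a4 : F j * 2 ^ (j.choose 2) < 1 * 2 ^ (j.choose 2) := by linarith
    exact lt_of_mul_lt_mul_right a4 (by positivity)
  obtain ⟨p, hp1, hp2, hp3⟩ := profile_exists n k t J F hF ht hJ hkn.le hsum hsum2 hF0 hF1 hFJ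
  have hrefl : ∀ j ∈ Finset.range t, t - (t - j) = j := by
    intro j hj; have := Finset.mem_range.1 hj; omega
  have hP1 : ∑ u ∈ Finset.Icc 1 t, (fun u => p (t - u)) u = k := by
    rw [← hp1, sum_reflect]
    exact Finset.sum_congr rfl fun j hj => by simp only [hrefl j hj]
  have hP2 : ∑ u ∈ Finset.Icc 1 t, u * (fun u => p (t - u)) u = n := by
    rw [← hp2, sum_reflect]
    exact Finset.sum_congr rfl fun j hj => by simp only [hrefl j hj]
  refine ⟨logE_upper n k t A x hA hx hk (by omega) hs1 hs2 (E_pos n k t _ hP1 hP2), ?_⟩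
  have hlow := logE_lower n k t A x hA hx hs1 hs2 _ hP1 hP2
  rw [sum_reflect] at hlow
  have hge : -(2 * t + J * Real.log n) ≤ ∑ j ∈ Finset.range t,
      ((p (t - (t - j)) : ℝ) * Real.log (A * x ^ (t - j) / dcoef (t - j))
        - A * x ^ (t - j) / dcoef (t - j) - Real.log (p (t - (t - j))).factorial) := by
    have hln : 0 ≤ Real.log n := Real.log_natCast_nonneg n
    calc -(2 * t + J * Real.log n)
        ≤ ∑ j ∈ Finset.range t, (-2 - (if j < J then Real.log n else 0)) := by
          rw [Finset.sum_sub_distrib, Finset.sum_const, Finset.card_range, ← Finset.sum_filter,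
            Finset.sum_const]
          have hc : ((Finset.range t).filter (fun j => j < J)).card ≤ J := by
            calc _ ≤ (Finset.range J).card := Finset.card_le_card (by
                  intro j hj; simp at hj ⊢; exact hj.2)
              _ = J := Finset.card_range J
          have hc' : ((((Finset.range t).filter (fun j => j < J)).card : ℕ):ℝ) ≤ J := by
            exact_mod_cast hc
          have := mul_le_mul_of_nonneg_right hc' hln
          simp only [nsmul_eq_mul]
          linarith
      _ ≤ _ := by
          apply Finset.sum_le_sum
          intro j hj
          have := hp3 j hj
          rw [hrefl j hj]
          exact this
  linarith

lemma J_growth (n : ℕ) (b : ℝ) (hb : 0 < b) (hn : 1 ≤ Real.log n) (J : ℕ)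
    (hJ : (4 + 4 * Real.log (1 + b)) * Real.sqrt (Real.log n) + 2 ≤ J) :
    ∀ j, J ≤ j → (n:ℝ) * (1 + b) ^ j < 2 ^ (j.choose 2) := by
  intro j hj
  set l := Real.log n with hl
  set B := Real.log (1 + b) with hB
  have hB0 : 0 < B := Real.log_pos (by linarith)
  set s := Real.sqrt l with hs
  have hss : s * s = l := Real.mul_self_sqrt (by linarith)
  have hs1 : 1 ≤ s := by rw [hs]; exact Real.one_le_sqrt.2 hn
  have hj' : (J:ℝ) ≤ j := by exact_mod_cast hj
  have hn0 : (0:ℝ) < n := by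
    rcases Nat.eq_zero_or_pos n with h | h
    · subst h; simp at hl; linarith
    · exact_mod_cast h
  have hlog : Real.log ((n:ℝ) * (1 + b) ^ j) < Real.log ((2:ℝ) ^ (j.choose 2)) := by
    rw [Real.log_mul (by positivity) (by positivity), Real.log_pow, Real.log_pow,
      Nat.cast_choose_two]
    have h2 : (1:ℝ)/2 < Real.log 2 := by have := Real.log_two_gt_d9; linarith
    set y : ℝ := (j:ℝ) with hy
    have hBs : B ≤ B * s := by nlinarith
    have hy1 : 4 * s + 4 * B + 2 ≤ y := by nlinarith
    have c1 : y * (y - 1) / 4 ≤ y * (y - 1) / 2 * Real.log 2 := by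
      have : 0 ≤ y * (y - 1) / 2 := by
        have : 0 ≤ y * (y-1) := mul_nonneg (by linarith) (by linarith)
        linarith
      nlinarith
    have c2 : l + y * B < y * (y - 1) / 4 := by
      have : y * (4 * s + 4 * B + 1) ≤ y * (y - 1) :=
        mul_le_mul_of_nonneg_left (by linarith) (by linarith)
      have : s * s ≤ y * s := mul_le_mul_of_nonneg_right (by linarith) (by linarith)
      nlinarith
    change l + y * B < _
    linarith
  exact (Real.log_lt_log_iff (by positivity) (by positivity)).1 hlog


lemma alpha_bounds : Tendsto (fun n : ℕ => alpha0 2 n) atTop atTop ∧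
    ∀ᶠ n : ℕ in atTop, alpha0 2 n ≤ 6 * Real.log n := by
  have hl2 : (1:ℝ)/2 < Real.log 2 := by have := Real.log_two_gt_d9; linarith
  have hlog : Tendsto (fun n : ℕ => Real.log n) atTop atTop :=
    Real.tendsto_log_atTop.comp tendsto_natCast_atTop_atTop
  have hy : Tendsto (fun n : ℕ => Real.logb 2 n) atTop atTop := by
    simp only [Real.logb]
    exact hlog.atTop_div_const (by linarith)
  set c : ℝ := 2 * Real.logb 2 (Real.exp 1 / 2) + 1 with hc
  have hlo : ∀ᶠ y : ℝ in atTop, Real.logb 2 y ≤ y / 2 := by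
    have h := Real.isLittleO_log_id_atTop.bound (show (0:ℝ) < 1/4 by norm_num)
    filter_upwards [h, eventually_ge_atTop 1] with y h1 h2
    rw [Real.norm_eq_abs, Real.norm_eq_abs, abs_of_nonneg (Real.log_nonneg h2), id,
      abs_of_nonneg (by linarith)] at h1
    rw [Real.logb, div_le_iff₀ (by linarith)]
    nlinarith
  constructor
  · have : Tendsto (fun n : ℕ => Real.logb 2 n + c) atTop atTop :=
      tendsto_atTop_add_const_right _ _ hy
    refine tendsto_atTop_mono' _ ?_ this
    filter_upwards [hy.eventually hlo] with n h
    unfold alpha0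
    linarith
  · filter_upwards [hy.eventually (eventually_ge_atTop 1), hy.eventually (eventually_ge_atTop c)]
      with n h1 h2
    have h3 : 0 ≤ Real.logb 2 (Real.logb 2 n) := Real.logb_nonneg (by norm_num) h1
    have h4 : Real.logb 2 n * Real.log 2 = Real.log n := by
      rw [Real.logb]; field_simp
    have : alpha0 2 n ≤ 3 * Real.logb 2 n := by
      unfold alpha0; linarith
    nlinarith

theorem main_thm (k t : ℕ → ℕ)
    (ht : ∃ C : ℝ, ∀ᶠ n : ℕ in atTop, |(alphaNat 2 n : ℝ) - (t n : ℝ)| ≤ C)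
    (hk : ∃ c₁ c₂ : ℝ, 0 < c₁ ∧ c₁ ≤ c₂ ∧ ∀ᶠ n : ℕ in atTop,
      c₁ ≤ (t n : ℝ) - (n : ℝ) / (k n : ℝ) ∧ (t n : ℝ) - (n : ℝ) / (k n : ℝ) ≤ c₂) :
    ∃ C : ℝ, 0 < C ∧ ∀ᶠ n : ℕ in atTop,
      |Real.log (Enkt n (k n) (t n)) - L0 n (k n) (t n)| ≤
        C * Real.log n ^ ((3:ℝ)/2) := by
  obtain ⟨C, hC⟩ := ht
  obtain ⟨c₁, c₂, hc1, hc12, hk⟩ := hk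
  have hc2 : 0 < c₂ := by linarith
  obtain ⟨ha1, ha2⟩ := alpha_bounds
  have hlog : Tendsto (fun n : ℕ => Real.log n) atTop atTop :=
    Real.tendsto_log_atTop.comp tendsto_natCast_atTop_atTop
  obtain ⟨M, hM⟩ := exists_nat_ge (2 * c₂)
  set b : ℝ := 4 ^ M * (2 * c₂) with hb
  have hb0 : 0 < b := by positivity
  have hM0 : (0:ℝ) < M := by linarith
  set D : ℝ := 2 * M * (1 + b) ^ M with hD
  have hD0 : 0 < D := by positivity
  have hB0 : 0 < Real.log (1 + b) := Real.log_pos (by linarith)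
  set C' : ℝ := 4 + 4 * Real.log (1 + b) with hC'
  have hC'0 : 0 < C' := by positivity
  set m : ℝ := min 1 c₁ with hm
  have hm0 : 0 < m := lt_min one_pos hc1
  have hpow : ∀ᶠ n : ℕ in atTop, (7 * Real.log n) ^ 5 * D ≤ m * n := by
    have h := (Real.isLittleO_pow_log_id_atTop (n := 5)).bound
      (show (0:ℝ) < m / (7 ^ 5 * D) by positivity)
    filter_upwards [tendsto_natCast_atTop_atTop.eventually h,
      hlog.eventually (eventually_ge_atTop 0)] with n h1 h2
    rw [Real.norm_eq_abs, Real.norm_eq_abs, abs_of_nonneg (by positivity), id,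
      abs_of_nonneg (by positivity), div_mul_eq_mul_div, le_div_iff₀ (by positivity)] at h1
    rw [mul_pow]
    linarith
  refine ⟨17 + C', by positivity, ?_⟩
  filter_upwards [hC, hk, ha2, ha1.eventually (eventually_ge_atTop (C + c₂ + M + 4)), hpow,
    hlog.eventually (eventually_ge_atTop 1), hlog.eventually (eventually_ge_atTop C),
    eventually_ge_atTop 1] with n hCn hkn hup hlow hpw hl1 hlC hn1
  obtain ⟨hka, hkb⟩ := hkn
  have hn0 : (0:ℝ) < n := by exact_mod_cast hn1
  have hC0 : 0 ≤ C := le_trans (abs_nonneg _) hCn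
  obtain ⟨hCa, hCb⟩ := abs_le.1 hCn
  have hfl1 : (alphaNat 2 n : ℝ) ≤ alpha0 2 n := Nat.floor_le (by linarith)
  have hfl2 : alpha0 2 n < alphaNat 2 n + 1 := Nat.lt_floor_add_one _
  have htlow : c₂ + M + 3 ≤ (t n : ℝ) := by linarith
  have htup : (t n : ℝ) ≤ 7 * Real.log n := by linarith
  have hkpos : 0 < k n := by
    rcases Nat.eq_zero_or_pos (k n) with h | h
    · rw [h] at hkb; simp at hkb; linarith
    · exact h
  have hk0 : (0:ℝ) < k n := by exact_mod_cast hkpos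
  have hq : (n:ℝ) / k n * k n = n := by field_simp
  have h1 : c₁ * k n ≤ t n * k n - n := by
    have := mul_le_mul_of_nonneg_right hka hk0.le
    rw [sub_mul, hq] at this; exact this
  have h2 : (t n : ℝ) * k n - n ≤ c₂ * k n := by
    have := mul_le_mul_of_nonneg_right hkb hk0.le
    rw [sub_mul, hq] at this; exact this
  have hkltn : k n < n := by
    have : (k n : ℝ) < n := by
      rw [← hq]
      have : 1 < (n:ℝ) / k n := by linarith
      nlinarith
    exact_mod_cast this
  have ht0 : (0:ℝ) < t n := by linarith
  have hMt : M < t n := by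
    have : (M:ℝ) < t n := by linarith
    exact_mod_cast this
  have ht2 : 2 ≤ t n := by
    have : (2:ℝ) ≤ t n := by linarith
    exact_mod_cast this
  have hbig : (t n : ℝ) ^ 4 * D ≤ m * k n := by
    have e1 : (t n : ℝ) ^ 5 * D ≤ (7 * Real.log n) ^ 5 * D :=
      mul_le_mul_of_nonneg_right (pow_le_pow_left₀ ht0.le htup 5) hD0.le
    have e2 : (n:ℝ) ≤ t n * k n := by
      have : 0 < c₁ * k n := by positivity
      linarith
    have e3 : m * n ≤ m * (t n * k n) := mul_le_mul_of_nonneg_left e2 hm0.le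
    have : (t n : ℝ) ^ 4 * D * t n ≤ m * k n * t n := by nlinarith
    exact le_of_mul_le_mul_right this ht0
  set s := Real.sqrt (Real.log n) with hs
  have hs1 : 1 ≤ s := by rw [hs]; exact Real.one_le_sqrt.2 hl1
  set J : ℕ := ⌈C' * s⌉₊ + 2 with hJ
  have hJr : (J:ℝ) = (⌈C' * s⌉₊ : ℝ) + 2 := by rw [hJ]; push_cast; ring
  have hJ1 : C' * s + 2 ≤ J := by rw [hJr]; have := Nat.le_ceil (C' * s); linarith
  have hJ2 : (J:ℝ) ≤ C' * s + 3 := by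
    rw [hJr]
    have := Nat.ceil_lt_add_one (show 0 ≤ C' * s by positivity)
    linarith
  obtain ⟨u1, u2⟩ := det_bound n (k n) (t n) M J c₁ c₂ hc1 hc2 hM hMt ht2 hkpos hkltn h1 h2
    (le_trans hbig (by
      have := mul_le_mul_of_nonneg_right (min_le_left 1 c₁) hk0.le
      linarith))
    (le_trans hbig (mul_le_mul_of_nonneg_right (min_le_right 1 c₁) hk0.le))
    (by omega) (J_growth n b hb0 hl1 J hJ1)
  have h32 : Real.log n ^ ((3:ℝ)/2) = Real.log n * s := by
    rw [hs, Real.sqrt_eq_rpow]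
    nth_rewrite 2 [← Real.rpow_one (Real.log n)]
    rw [← Real.rpow_add (by linarith)]
    norm_num
  rw [h32]
  have hl0 : (0:ℝ) ≤ Real.log n := by linarith
  have hls : Real.log n ≤ Real.log n * s := le_mul_of_one_le_right hl0 hs1
  have hJl : J * Real.log n ≤ (C' * s + 3) * Real.log n := mul_le_mul_of_nonneg_right hJ2 hl0
  have hCl : 0 ≤ C' * (Real.log n * s) := by positivity
  rw [abs_le]
  constructor
  · have : (C' * s + 3) * Real.log n = C' * (Real.log n * s) + 3 * Real.log n := by ring
    have : (17 + C') * (Real.log n * s) = 17 * (Real.log n * s) + C' * (Real.log n * s) := by ring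
    linarith
  · have : (17 + C') * (Real.log n * s) = 17 * (Real.log n * s) + C' * (Real.log n * s) := by ring
    linarith

/-- Lemma 7.27: `ln E_{n,k,t} = L₀(n,k,t) + O(ln^{3/2} n)` whenever `t = α − O(1)` and
`n/k = t − Θ(1)`. -/
theorem log_Enkt_eq_L0 (k t : ℕ → ℕ)
    (ht : ∃ C : ℝ, ∀ᶠ n : ℕ in atTop, |(alphaNat 2 n : ℝ) - (t n : ℝ)| ≤ C)
    (hk : ∃ c₁ c₂ : ℝ, 0 < c₁ ∧ c₁ ≤ c₂ ∧ ∀ᶠ n : ℕ in atTop,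
      c₁ ≤ (t n : ℝ) - (n : ℝ) / (k n : ℝ) ∧ (t n : ℝ) - (n : ℝ) / (k n : ℝ) ≤ c₂) :
    ∃ C : ℝ, 0 < C ∧ ∀ᶠ n : ℕ in atTop,
      |Real.log (Enkt n (k n) (t n)) - L0 n (k n) (t n)| ≤
        C * Real.log n ^ ((3:ℝ)/2) := by
  exact main_thm k t ht hk
end
end

section
/- Let p = 1/2 and let a = a(n) ∈ {α(n)−2, α(n)−1}. Then with high probability χ_a(G_{n,1/2}) ≥ k_a(n) − 1, where k_a(n) is the a-bounded first moment threshold. -/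
open Filter
open scoped BigOperators Classical

noncomputable section

/-- The valid unordered colourings, as a set. -/
def colSet (n t k : ℕ) (G : SimpleGraph (Fin n)) : Set (Finset (Finset (Fin n))) :=
  {Q : Finset (Finset (Fin n)) | Q.card = k ∧
    (∀ s ∈ Q, s.Nonempty ∧ s.card ≤ t ∧ IndepFinset G s) ∧
    (∀ v : Fin n, ∃ s ∈ Q, v ∈ s) ∧
    ∀ s ∈ Q, ∀ s' ∈ Q, s ≠ s' → Disjoint s s'}

lemma num_eq (n t k : ℕ) (G : SimpleGraph (Fin n)) :
    numUnorderedColourings n t k G = (colSet n t k G).ncard := rfl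

/-- Splitting off single vertices produces many colourings with one more colour. -/
lemma refine_count {n t k : ℕ} {G : SimpleGraph (Fin n)} {Q : Finset (Finset (Fin n))}
    (hQ : Q ∈ colSet n t k G) : n - k ≤ numUnorderedColourings n t (k + 1) G := by
  obtain ⟨hc, hp, hcov, hdis⟩ := hQ
  choose r hr using fun s (hs : s ∈ Q) => (hp s hs).1
  choose part hpart hmem using hcov
  have huniq : ∀ v s, s ∈ Q → v ∈ s → s = part v := by
    intro v s hs hv
    by_contra hne
    exact Finset.disjoint_left.1 (hdis s hs _ (hpart v) hne) hv (hmem v)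
  let R : Finset (Fin n) := Finset.univ.image (fun s : {s // s ∈ Q} => r s.1 s.2)
  have hR : R.card ≤ k := by
    refine Finset.card_image_le.trans ?_
    simp [hc]
  let W : Finset (Fin n) := Rᶜ
  have hW : n - k ≤ W.card := by
    have : W.card = n - R.card := by simp [W, Finset.card_compl]
    omega
  let F : Fin n → Finset (Finset (Fin n)) := fun v =>
    insert {v} (insert ((part v).erase v) (Q.erase (part v)))
  have hrne : ∀ v ∈ W, ∀ s (hs : s ∈ Q), r s hs ≠ v := by
    intro v hv s hs h
    apply (Finset.mem_compl.1 hv)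
    exact Finset.mem_image.2 ⟨⟨s, hs⟩, Finset.mem_univ _, h⟩
  have hsing : ∀ v ∈ W, ({v} : Finset (Fin n)) ∉ Q := by
    intro v hv hs
    have := hr _ hs
    exact hrne v hv _ hs (by simpa using this)
  have hsing2 : ∀ v ∈ W, ∀ w ∈ W, ({v} : Finset (Fin n)) ≠ (part w).erase w := by
    intro v hv w hw h
    have h1 : r _ (hpart w) ∈ (part w).erase w :=
      Finset.mem_erase.2 ⟨hrne w hw _ _, hr _ _⟩
    rw [← h, Finset.mem_singleton] at h1
    exact hrne v hv _ _ h1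
  have hFm : ∀ v ∈ W, F v ∈ colSet n t (k + 1) G := by
    intro v hv
    have hen : ((part v).erase v).Nonempty :=
      ⟨r _ (hpart v), Finset.mem_erase.2 ⟨hrne v hv _ _, hr _ _⟩⟩
    have heQ : (part v).erase v ∉ Q.erase (part v) := by
      intro h
      obtain ⟨x, hx⟩ := hen
      have h1 := huniq x _ (Finset.mem_of_mem_erase h) hx
      have h2 := huniq x _ (hpart v) (Finset.mem_of_mem_erase hx)
      exact (Finset.mem_erase.1 h).1 (h1.trans h2.symm)
    have hkpos : 0 < Q.card := Finset.card_pos.2 ⟨_, hpart v⟩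
    refine ⟨?_, ?_, ?_, ?_⟩
    · rw [Finset.card_insert_of_notMem, Finset.card_insert_of_notMem heQ,
        Finset.card_erase_of_mem (hpart v)]
      · omega
      · intro h
        rcases Finset.mem_insert.1 h with h | h
        · exact hsing2 v hv v hv h
        · exact hsing v hv (Finset.mem_of_mem_erase h)
    · intro s hs
      obtain ⟨_, p2, p3⟩ := hp _ (hpart v)
      rcases Finset.mem_insert.1 hs with rfl | h
      · refine ⟨Finset.singleton_nonempty _, ?_, ?_⟩
        · exact (Finset.card_le_card (Finset.singleton_subset_iff.2 (hmem v))).trans p2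
        · intro x hx y hy
          rw [Finset.mem_singleton] at hx hy
          subst hx; subst hy; simp
      · rcases Finset.mem_insert.1 h with rfl | h
        · refine ⟨hen, (Finset.card_le_card (Finset.erase_subset _ _)).trans p2, ?_⟩
          intro x hx y hy
          exact p3 x (Finset.mem_of_mem_erase hx) y (Finset.mem_of_mem_erase hy)
        · exact hp s (Finset.mem_of_mem_erase h)
    · intro x
      by_cases hxv : x = v
      · exact ⟨{v}, by simp [F], by simp [hxv]⟩
      by_cases hxp : x ∈ part v
      · exact ⟨(part v).erase v, by simp [F], Finset.mem_erase.2 ⟨hxv, hxp⟩⟩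
      · refine ⟨part x, ?_, hmem x⟩
        simp only [F, Finset.mem_insert, Finset.mem_erase]
        right; right
        refine ⟨?_, hpart x⟩
        intro h
        exact hxp (h ▸ hmem x)
    · have hd1 : Disjoint ({v} : Finset (Fin n)) ((part v).erase v) := by simp
      have hd2 : ∀ s ∈ Q.erase (part v), Disjoint (part v) s := by
        intro s hs
        exact hdis _ (hpart v) s (Finset.mem_of_mem_erase hs) (Finset.mem_erase.1 hs).1.symm
      have hd3 : ∀ s ∈ Q.erase (part v), Disjoint ({v} : Finset (Fin n)) s := fun s hs =>
        Finset.disjoint_of_subset_left (Finset.singleton_subset_iff.2 (hmem v)) (hd2 s hs)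
      have hd4 : ∀ s ∈ Q.erase (part v), Disjoint ((part v).erase v) s := fun s hs =>
        Finset.disjoint_of_subset_left (Finset.erase_subset _ _) (hd2 s hs)
      intro s hs s' hs' hne
      rcases Finset.mem_insert.1 hs with h | h
      · rcases Finset.mem_insert.1 hs' with h' | h'
        · exact absurd (h.trans h'.symm) hne
        · rcases Finset.mem_insert.1 h' with h' | h'
          · rw [h, h']; exact hd1
          · rw [h]; exact hd3 _ h'
      · rcases Finset.mem_insert.1 h with h | h
        · rcases Finset.mem_insert.1 hs' with h' | h'
          · rw [h, h']; exact hd1.symm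
          · rcases Finset.mem_insert.1 h' with h' | h'
            · exact absurd (h.trans h'.symm) hne
            · rw [h]; exact hd4 _ h'
        · rcases Finset.mem_insert.1 hs' with h' | h'
          · rw [h']; exact (hd3 _ h).symm
          · rcases Finset.mem_insert.1 h' with h' | h'
            · rw [h']; exact (hd4 _ h).symm
            · exact hdis _ (Finset.mem_of_mem_erase h) _ (Finset.mem_of_mem_erase h') hne
  have hinj : Set.InjOn F (W : Set (Fin n)) := by
    intro v hv w hw h
    have h1 : ({v} : Finset (Fin n)) ∈ F w := by rw [← h]; simp [F]
    rcases Finset.mem_insert.1 h1 with h1 | h1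
    · simpa using h1
    · rcases Finset.mem_insert.1 h1 with h1 | h1
      · exact absurd h1 (hsing2 v hv w hw)
      · exact absurd (Finset.mem_of_mem_erase h1) (hsing v hv)
  rw [num_eq]
  calc n - k ≤ W.card := hW
    _ = (W.image F).card := (Finset.card_image_of_injOn hinj).symm
    _ = ((W.image F : Finset _) : Set (Finset (Finset (Fin n)))).ncard :=
        (Set.ncard_coe_finset _).symm
    _ ≤ _ := Set.ncard_le_ncard (by
        intro q hq
        obtain ⟨v, hv, rfl⟩ := Finset.mem_image.1 (Finset.mem_coe.1 hq)
        exact hFm v hv) (Set.toFinite _)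

/-- The partition given by the fibres of a proper bounded colouring. -/
lemma colSet_of_map {n t : ℕ} {β : Type} {G : SimpleGraph (Fin n)} (C : Fin n → β)
    (h1 : ∀ v w, G.Adj v w → C v ≠ C w)
    (h2 : ∀ v, (Finset.univ.filter fun w => C w = C v).card ≤ t) :
    (colSet n t (Finset.univ.image C).card G).Nonempty := by
  refine ⟨(Finset.univ.image C).image (fun c => Finset.univ.filter fun w => C w = c), ?_, ?_, ?_, ?_⟩
  · apply Finset.card_image_of_injOn
    intro c hc d hd h
    obtain ⟨v, _, rfl⟩ := Finset.mem_image.1 (Finset.mem_coe.1 hc)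
    have : v ∈ Finset.univ.filter fun w => C w = C v := by simp
    have h' : (Finset.univ.filter fun w => C w = C v) = Finset.univ.filter fun w => C w = d := h
    rw [h'] at this
    simpa using this
  · intro s hs
    obtain ⟨c, hc, rfl⟩ := Finset.mem_image.1 hs
    obtain ⟨v, _, rfl⟩ := Finset.mem_image.1 hc
    refine ⟨⟨v, by simp⟩, h2 v, ?_⟩
    intro x hx y hy hadj
    simp only [Finset.mem_filter, Finset.mem_univ, true_and] at hx hy
    exact h1 x y hadj (hx.trans hy.symm)
  · intro v
    exact ⟨_, Finset.mem_image.2 ⟨C v, Finset.mem_image.2 ⟨v, Finset.mem_univ _, rfl⟩, rfl⟩, by simp⟩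
  · intro s hs s' hs' hne
    obtain ⟨c, hc, rfl⟩ := Finset.mem_image.1 hs
    obtain ⟨d, hd, rfl⟩ := Finset.mem_image.1 hs'
    rw [Finset.disjoint_left]
    intro x hx hx'
    simp only [Finset.mem_filter, Finset.mem_univ, true_and] at hx hx'
    exact hne (by rw [← hx, ← hx'])

lemma colSet_mono {n t j : ℕ} {G : SimpleGraph (Fin n)} (h : (colSet n t j G).Nonempty) (k : ℕ)
    (hjk : j ≤ k) (hk : k ≤ n) : (colSet n t k G).Nonempty := by
  induction k, hjk using Nat.le_induction with
  | base => exact h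
  | succ k hk' ih =>
    obtain ⟨Q, hQ⟩ := ih (by omega)
    have := refine_count hQ
    rw [num_eq] at this
    exact Set.nonempty_of_ncard_ne_zero (by omega)

lemma colSet_of_bounded {n t j : ℕ} {G : SimpleGraph (Fin n)} (h : HasBoundedColouring G t j) (k : ℕ)
    (hjk : j ≤ k) (hk : k ≤ n) : (colSet n t k G).Nonempty := by
  obtain ⟨C, h1, h2⟩ := h
  refine colSet_mono (colSet_of_map C h1 fun v => by convert h2 (C v)) k (le_trans ?_ hjk) hk
  exact (Finset.card_le_univ _).trans (by simp)

/-- Merging the non-adjacent pairs `{2i, 2i+1}`. -/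
lemma pairs_colSet {n t : ℕ} (ht : 2 ≤ t) (G : SimpleGraph (Fin n)) (J : Finset (Fin n))
    (p : Fin n → Fin n)
    (hJ : ∀ v ∈ J, (v : ℕ) % 2 = 1 ∧ (p v : ℕ) + 1 = v ∧ ¬ G.Adj (p v) v) :
    (colSet n t (n - J.card) G).Nonempty := by
  let f : Fin n → Fin n := fun v => if v ∈ J then p v else v
  have hf : ∀ v w, f v = f w → v = w ∨ (v ∈ J ∧ w = p v) ∨ (w ∈ J ∧ v = p w) := by
    intro v w h
    simp only [f] at h
    split_ifs at h with h1 h2 h2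
    · left
      have a1 := (hJ v h1).2.1
      have a2 := (hJ w h2).2.1
      rw [h] at a1
      exact Fin.ext (by omega)
    · right; left; exact ⟨h1, h.symm⟩
    · right; right; exact ⟨h2, h⟩
    · left; exact h
  have hpJ : ∀ v ∈ J, p v ∉ J := by
    intro v hv hv'
    have a1 := hJ v hv
    have a2 := hJ _ hv'
    omega
  refine colSet_mono (colSet_of_map f ?_ ?_) _ ?_ (by omega)
  · intro v w hadj h
    rcases hf v w h with h | ⟨h1, h2⟩ | ⟨h1, h2⟩
    · exact hadj.ne h
    · exact (hJ v h1).2.2 (h2 ▸ hadj.symm)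
    · exact (hJ w h1).2.2 (h2 ▸ hadj)
  · intro v
    refine le_trans ?_ ht
    by_contra hcon
    obtain ⟨x, y, z, hx, hy, hz, hxy, hxz, hyz⟩ := Finset.two_lt_card_iff.1 (not_le.1 hcon)
    simp only [Finset.mem_filter, Finset.mem_univ, true_and] at hx hy hz
    have e1 := hf x y (hx.trans hy.symm)
    have e2 := hf x z (hx.trans hz.symm)
    have e3 := hf y z (hy.trans hz.symm)
    have key : ∀ u w : Fin n, u ∈ J → w ∈ J → p u = p w → u = w := by
      intro u w hu hw h
      have a1 := (hJ u hu).2.1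
      have a2 := (hJ w hw).2.1
      rw [h] at a1
      exact Fin.ext (by omega)
    grind
  · have hsub : Finset.univ.image f ⊆ Jᶜ := by
      intro x hx
      obtain ⟨v, _, rfl⟩ := Finset.mem_image.1 hx
      rw [Finset.mem_compl]
      simp only [f]
      split_ifs with h
      · exact hpJ v h
      · exact h
    have h9 := Finset.card_le_card hsub
    rw [Finset.card_compl, Fintype.card_fin] at h9
    convert h9

lemma two_le_sum {n t m : ℕ} (ht : 2 ≤ t) (hm : 1 ≤ m) (hn : 4 * (m + 1) ≤ n)
    (G : SimpleGraph (Fin n)) :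
    2 ≤ numUnorderedColourings n t (n - m) G + numUnorderedColourings n t (n - m) Gᶜ := by
  let p : Fin n → Fin n := fun v => ⟨v - 1, by omega⟩
  let O : Finset (Fin n) := Finset.univ.filter fun v => (v : ℕ) % 2 = 1
  have hO : 2 * (m + 1) ≤ O.card := by
    have : Finset.univ.image (fun i : Fin (2 * (m + 1)) =>
        (⟨2 * i + 1, by omega⟩ : Fin n)) ⊆ O := by
      intro x hx
      obtain ⟨i, _, rfl⟩ := Finset.mem_image.1 hx
      simp only [O, Finset.mem_filter, Finset.mem_univ, true_and]
      omega
    have h2 := Finset.card_le_card this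
    rw [Finset.card_image_of_injective] at h2
    · simpa using h2
    · intro i j h
      simp only [Fin.mk.injEq] at h
      exact Fin.ext (by omega)
  have key : ∀ H : SimpleGraph (Fin n), m + 1 ≤ (O.filter fun v => ¬ H.Adj (p v) v).card →
      2 ≤ numUnorderedColourings n t (n - m) H := by
    intro H hH
    have h0 := pairs_colSet ht H (O.filter fun v => ¬ H.Adj (p v) v) p (by
      intro v hv
      simp only [O, Finset.mem_filter, Finset.mem_univ, true_and] at hv
      refine ⟨hv.1, ?_, hv.2⟩
      simp only [p]
      omega)
    obtain ⟨Q, hQ⟩ := colSet_mono h0 (n - (m + 1)) (by omega) (by omega)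
    have := refine_count hQ
    rw [show n - (m + 1) + 1 = n - m by omega] at this
    omega
  have hsplit := Finset.card_filter_add_card_filter_not (s := O) (fun v => ¬ G.Adj (p v) v)
  by_cases h : m + 1 ≤ (O.filter fun v => ¬ G.Adj (p v) v).card
  · have := key G h
    omega
  · have h2 : (O.filter fun v => ¬ ¬ G.Adj (p v) v).card ≤
        (O.filter fun v => ¬ Gᶜ.Adj (p v) v).card := by
      apply Finset.card_le_card
      intro v hv
      simp only [Finset.mem_filter, not_not] at hv ⊢
      refine ⟨hv.1, fun h => ?_⟩
      rw [SimpleGraph.compl_adj] at h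
      exact h.2 hv.2
    have h3 : m + 1 ≤ (O.filter fun v => ¬ ¬ G.Adj (p v) v).card := by omega
    have h4 := Nat.le_trans h3 h2
    have := key Gᶜ (by convert h4)
    omega

lemma edgeCount_le {n : ℕ} (G : SimpleGraph (Fin n)) : edgeCount G ≤ n.choose 2 := by
  have := SimpleGraph.card_edgeFinset_le_card_choose_two (G := G)
  rw [Fintype.card_fin] at this
  unfold edgeCount
  rwa [Nat.card_eq_fintype_card, ← SimpleGraph.edgeFinset_card]

lemma Ep_half (n : ℕ) (X : SimpleGraph (Fin n) → ℝ) :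
    Ep n (1/2) X = (∑ G, X G) * (1/2) ^ (n.choose 2) := by
  unfold Ep
  rw [finsum_eq_sum_of_fintype, Finset.sum_mul]
  refine Finset.sum_congr rfl fun G _ => ?_
  rw [show (1 - 1/2 : ℝ) = 1/2 by norm_num, mul_assoc, ← pow_add,
    Nat.add_sub_cancel' (edgeCount_le G)]

lemma card_graphs (n : ℕ) : Fintype.card (SimpleGraph (Fin n)) = 2 ^ n.choose 2 := by
  let e : SimpleGraph (Fin n) ≃ Set {x : Sym2 (Fin n) // ¬ x.IsDiag} :=
    { toFun := fun G => {x | x.1 ∈ G.edgeSet}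
      invFun := fun S => SimpleGraph.fromEdgeSet (Subtype.val '' S)
      left_inv := by
        intro G
        ext v w
        simp only [SimpleGraph.fromEdgeSet_adj, Set.mem_image, Set.mem_ofPred_eq]
        constructor
        · rintro ⟨⟨x, hx, hxe⟩, _⟩
          rw [hxe] at hx
          exact hx
        · intro h
          exact ⟨⟨⟨s(v, w), by simpa using h.ne⟩, h, rfl⟩, h.ne⟩
      right_inv := by
        intro S
        ext ⟨x, hx⟩
        simp only [SimpleGraph.edgeSet_fromEdgeSet, Set.mem_ofPred_eq, Set.mem_sdiff]
        constructor
        · rintro ⟨⟨y, hy, rfl⟩, _⟩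
          exact hy
        · intro h
          exact ⟨⟨_, h, rfl⟩, by simpa using hx⟩ }
  rw [Fintype.card_congr e, Fintype.card_set, Sym2.card_subtype_not_diag, Fintype.card_fin]

/-- Indicator of a proposition. -/
def ind (p : Prop) : ℝ := if p then 1 else 0

lemma Pp_half (n : ℕ) (E : SimpleGraph (Fin n) → Prop) :
    Pp n (1/2) E = Ep n (1/2) fun G => ind (E G) := rfl

lemma Ep_one (n : ℕ) : Ep n (1/2) (fun _ => 1) = 1 := by
  rw [Ep_half]
  simp [card_graphs]

lemma Ep_mono {n : ℕ} {X Y : SimpleGraph (Fin n) → ℝ} (h : ∀ G, X G ≤ Y G) :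
    Ep n (1/2) X ≤ Ep n (1/2) Y := by
  rw [Ep_half, Ep_half]
  exact mul_le_mul_of_nonneg_right (Finset.sum_le_sum fun G _ => h G) (by positivity)

lemma threshold_le {n t m : ℕ} (ht : 2 ≤ t) (hm : 1 ≤ m) (hn : 4 * (m + 1) ≤ n) :
    fmThreshold n t ≤ n - m := by
  apply Nat.sInf_le
  show 1 ≤ Ep n (1/2) fun G => (numUnorderedColourings n t (n - m) G : ℝ)
  have hsum : ∑ G : SimpleGraph (Fin n), (numUnorderedColourings n t (n - m) Gᶜ : ℝ) =
      ∑ G : SimpleGraph (Fin n), (numUnorderedColourings n t (n - m) G : ℝ) :=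
    Equiv.sum_comp (Function.Involutive.toPerm _ (compl_involutive (α := SimpleGraph (Fin n))))
      (fun G => (numUnorderedColourings n t (n - m) G : ℝ))
  have h1 : ∑ _G : SimpleGraph (Fin n), (2 : ℝ) ≤
      ∑ G : SimpleGraph (Fin n), ((numUnorderedColourings n t (n - m) G : ℝ) +
        (numUnorderedColourings n t (n - m) Gᶜ : ℝ)) :=
    Finset.sum_le_sum fun G _ => by exact_mod_cast two_le_sum ht hm hn G
  rw [Finset.sum_add_distrib, hsum] at h1
  refine (Ep_one n).symm.le.trans ?_
  rw [Ep_half, Ep_half]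
  refine mul_le_mul_of_nonneg_right ?_ (by positivity)
  simp only [Finset.sum_const, nsmul_eq_mul] at h1 ⊢
  linarith

lemma main_bound {n t m : ℕ} (ht : 2 ≤ t) (hm : 1 ≤ m) (hn : 4 * (m + 1) ≤ n) :
    1 - 1 / (m : ℝ) ≤ Pp n (1/2) fun G => fmThreshold n t - 1 ≤ chiBounded G t := by
  have hK := threshold_le ht hm hn
  set K := fmThreshold n t with hKdef
  have hmpos : (0 : ℝ) < m := by exact_mod_cast hm
  by_cases hK2 : K < 2
  · have : (1 : ℝ) ≤ Pp n (1/2) fun G => K - 1 ≤ chiBounded G t := by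
      rw [Pp_half]
      conv_lhs => rw [← Ep_one n]
      apply Ep_mono
      intro G
      have hex : K - 1 ≤ chiBounded G t := by
        omega
      simp [ind, hex]
    have h3 : 0 ≤ 1 / (m : ℝ) := by positivity
    linarith
  · have hlt : Enkt n (K - 1) t < 1 := by
      by_contra h
      have : K ≤ K - 1 := Nat.sInf_le (not_lt.1 h)
      omega
    have hpt : ∀ G : SimpleGraph (Fin n), (1 : ℝ) ≤ ind (K - 1 ≤ chiBounded G t) +
        (numUnorderedColourings n t (K - 1) G : ℝ) / m := by
      intro G
      unfold ind
      split_ifs with h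
      · have : (0 : ℝ) ≤ (numUnorderedColourings n t (K - 1) G : ℝ) / m := by positivity
        linarith
      · have hne : {k | HasBoundedColouring G t k}.Nonempty := by
          refine ⟨n, fun v => v, fun v w h => h.ne, fun c => ?_⟩
          have : (Finset.univ.filter fun v : Fin n => v = c).card ≤ 1 := by
            rw [Finset.card_le_one]
            intro a ha b hb
            simp only [Finset.mem_filter, Finset.mem_univ, true_and] at ha hb
            rw [ha, hb]
          refine le_trans ?_ (this.trans (by omega : 1 ≤ t))
          exact le_of_eq (by congr)
        have hmem : HasBoundedColouring G t (chiBounded G t) := Nat.sInf_mem hne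
        obtain ⟨Q, hQ⟩ := colSet_of_bounded hmem (K - 2) (by omega) (by omega)
        have h4 := refine_count hQ
        rw [show K - 2 + 1 = K - 1 by omega] at h4
        have h5 : m ≤ numUnorderedColourings n t (K - 1) G := by omega
        rw [zero_add, le_div_iff₀ hmpos, one_mul]
        exact_mod_cast h5
    have h6 := Ep_mono hpt
    rw [Ep_one, Ep_half, Finset.sum_add_distrib, add_mul, ← Ep_half, ← Finset.sum_div,
      div_mul_eq_mul_div, ← Ep_half n (fun G => (numUnorderedColourings n t (K - 1) G : ℝ))] at h6
    have h7 : (Ep n (1/2) fun G => (numUnorderedColourings n t (K - 1) G : ℝ)) / m ≤ 1 / m :=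
      div_le_div_of_nonneg_right hlt.le hmpos.le
    rw [Pp_half]
    linarith

lemma alpha_large : ∀ᶠ n : ℕ in atTop, 4 ≤ alphaNat 2 n := by
  have hlog : Tendsto (fun n : ℕ => Real.logb 2 n) atTop atTop :=
    (Real.tendsto_logb_atTop (by norm_num)).comp tendsto_natCast_atTop_atTop
  have hx : ∀ᶠ x : ℝ in atTop, 3 ≤ 2 * x - 2 * Real.logb 2 x := by
    have h1 : ∀ᶠ x : ℝ in atTop, ‖Real.log x‖ ≤ (Real.log 2 / 2) * ‖x‖ :=
      Real.isLittleO_log_id_atTop.bound (by positivity)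
    filter_upwards [h1, eventually_ge_atTop 3] with x h1 h3
    have hl2 : 0 < Real.log 2 := Real.log_pos (by norm_num)
    have h4 : Real.log x ≤ Real.log 2 / 2 * x := by
      have := (le_abs_self (Real.log x)).trans h1
      rwa [Real.norm_of_nonneg (by linarith)] at this
    have h5 : Real.logb 2 x ≤ x / 2 := by
      rw [Real.logb, div_le_iff₀ hl2]
      linarith
    linarith
  filter_upwards [hlog.eventually hx] with n hn
  apply Nat.le_floor
  have h6 : 0 ≤ Real.logb 2 (Real.exp 1 / 2) := by
    apply Real.logb_nonneg (by norm_num)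
    have := Real.add_one_le_exp 1
    linarith
  unfold alpha0
  push_cast
  linarith

lemma Pp_le_one (n : ℕ) (E : SimpleGraph (Fin n) → Prop) : Pp n (1/2) E ≤ 1 := by
  rw [Pp_half]
  conv_rhs => rw [← Ep_one n]
  apply Ep_mono
  intro G
  unfold ind
  split_ifs <;> norm_num

/-- Lemma 8.1: for `a ∈ {α−2, α−1}`, whp `χ_a(G_{n,1/2}) ≥ k_a − 1`. -/
theorem chi_bounded_lower_bound (a : ℕ → ℕ)
    (ha : ∀ n, a n = alphaNat 2 n - 2 ∨ a n = alphaNat 2 n - 1) :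
    Tendsto (fun n : ℕ => Pp n (1/2) fun G =>
      fmThreshold n (a n) - 1 ≤ chiBounded G (a n)) atTop (nhds 1) := by
  have hev : ∀ m : ℕ, 1 ≤ m → ∀ᶠ n : ℕ in atTop, 1 - 1 / (m : ℝ) ≤
      Pp n (1/2) fun G => fmThreshold n (a n) - 1 ≤ chiBounded G (a n) := by
    intro m hm
    filter_upwards [alpha_large, eventually_ge_atTop (4 * (m + 1))] with n h1 h2
    exact main_bound (by rcases ha n with h | h <;> omega) hm h2
  rw [tendsto_order]
  constructor
  · intro c hc
    obtain ⟨m, hm⟩ := exists_nat_one_div_lt (sub_pos.2 hc)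
    filter_upwards [hev (m + 1) (by omega)] with n hn
    push_cast at hn
    linarith
  · intro c hc
    exact Eventually.of_forall fun n => (Pp_le_one n _).trans_lt hc
end
end
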